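/- arXiv:math/0508130 — 2 statements merged into one kernel-verified Lean document; each statement's English description precedes it below -/
import Mathlib

section
/- Fix k ≥ 1. There exists a constant C (depending on k) such that for all natural numbers r ≥ 1, ∑_{t | r} 1/f_t ≤ (r/φ(r))^k ≤ C (log log(10r))^k, where f_t = ∏ p^{⌈v_p(t)/k⌉} and φ is Euler's totient function. -/
open Finset in
lemma aux_geom (k a : ℕ) (x : ℝ) (hk : 1 ≤ k) :
    ∑ j ∈ range (k * a), x ^ (j / k) = k * ∑ q ∈ range a, x ^ q := by
  induction a with
  | zero => simp
  | succ a ih =>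
    rw [Nat.mul_succ, Finset.sum_range_add, ih, Finset.sum_range_succ, mul_add]
    congr 1
    rw [Finset.sum_congr rfl (g := fun _ => x ^ a)]
    · simp
    · intro j hj
      have hj := Finset.mem_range.mp hj
      rw [Nat.mul_add_div (by omega), Nat.div_eq_of_lt hj, add_zero]

open Finset in
lemma aux_local (k a p : ℕ) (hk : 1 ≤ k) (hp : 2 ≤ p) :
    ∑ j ∈ range (a + 1), (1 : ℝ) / (p : ℝ) ^ ((j + k - 1) / k) ≤
      (1 + 1 / ((p : ℝ) - 1)) ^ k := by
  have hp' : (2 : ℝ) ≤ p := by exact_mod_cast hp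
  set x : ℝ := 1 / (p : ℝ) with hx
  have hx0 : 0 < x := by positivity
  have hx1 : x < 1 := by rw [hx, div_lt_one (by linarith)]; linarith
  have h1 : ∑ j ∈ range (a + 1), (1 : ℝ) / (p : ℝ) ^ ((j + k - 1) / k)
      = x * ∑ j ∈ range a, x ^ (j / k) + 1 := by
    rw [Finset.sum_range_succ']
    congr 1
    · rw [Finset.mul_sum]
      refine Finset.sum_congr rfl fun j _ => ?_
      have : (j + 1 + k - 1) / k = j / k + 1 := by
        rw [show j + 1 + k - 1 = j + k by omega, Nat.add_div_right _ (by omega)]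
      rw [this, hx, ← pow_succ', one_div_pow]
    · have : (k - 1) / k = 0 := Nat.div_eq_of_lt (by omega)
      simp [this]
  have h2 : ∑ j ∈ range a, x ^ (j / k) ≤ ∑ j ∈ range (k * a), x ^ (j / k) := by
    apply Finset.sum_le_sum_of_subset_of_nonneg
    · exact Finset.range_mono (Nat.le_mul_of_pos_left _ (by omega))
    · intros; positivity
  have h3 : ∑ q ∈ range a, x ^ q ≤ (1 - x)⁻¹ := by
    rw [← tsum_geometric_of_lt_one hx0.le hx1]
    exact (summable_geometric_of_lt_one hx0.le hx1).sum_le_tsum _ (fun _ _ => by positivity)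
  have h4 := one_add_mul_le_pow (a := 1 / ((p : ℝ) - 1))
    (by have : 0 ≤ 1 / ((p : ℝ) - 1) := by apply div_nonneg <;> linarith
        linarith) k
  rw [aux_geom k a x hk] at h2
  have h5 : x * (1 - x)⁻¹ = 1 / ((p : ℝ) - 1) := by
    have : (p : ℝ) - 1 ≠ 0 := by linarith
    rw [hx]; field_simp
  rw [h1]
  calc _ ≤ x * (k * (1 - x)⁻¹) + 1 := by
        gcongr
        exact h2.trans (by gcongr)
    _ = 1 + k * (x * (1 - x)⁻¹) := by ring
    _ ≤ _ := by rw [h5]; exact h4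

/-- The arithmetic function `t ↦ 1 / f_t`. -/
noncomputable def gFun (k : ℕ) : ArithmeticFunction ℝ :=
  ⟨fun t => if t = 0 then 0 else
    (1 : ℝ) / (∏ p ∈ t.primeFactors, p ^ ((t.factorization p + k - 1) / k) : ℕ), by simp⟩

lemma gFun_apply (k : ℕ) {t : ℕ} (ht : t ≠ 0) : gFun k t =
    (1 : ℝ) / (∏ p ∈ t.primeFactors, p ^ ((t.factorization p + k - 1) / k) : ℕ) := by
  simp [gFun, ht]

lemma gFun_mult (k : ℕ) : (gFun k).IsMultiplicative := by
  rw [ArithmeticFunction.IsMultiplicative.iff_ne_zero]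
  refine ⟨by simp [gFun], ?_⟩
  intro m n hm hn h
  rw [gFun_apply k hm, gFun_apply k hn, gFun_apply k (mul_ne_zero hm hn),
    h.primeFactors_mul, Finset.prod_union h.disjoint_primeFactors, Nat.cast_mul,
    div_mul_div_comm, one_mul]
  congr 3
  · refine Finset.prod_congr rfl fun p hp => ?_
    rw [Nat.factorization_eq_of_coprime_left h (by simpa using hp)]
  · refine Finset.prod_congr rfl fun p hp => ?_
    rw [Nat.factorization_eq_of_coprime_right h (by simpa using hp)]

lemma aux_first (k : ℕ) (hk : 1 ≤ k) (r : ℕ) (hr : r ≠ 0) :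
    (∑ t ∈ r.divisors, gFun k t) ≤ ((r : ℝ) / (Nat.totient r : ℝ)) ^ k := by
  induction r using Nat.recOnPosPrimePosCoprime with
  | zero => exact absurd rfl hr
  | one => simp [gFun]
  | prime_pow p n hp hn =>
    rw [Nat.sum_divisors_prime_pow hp]
    have h1 : ((p ^ n : ℕ) : ℝ) / (Nat.totient (p ^ n) : ℝ) = 1 + 1 / ((p : ℝ) - 1) := by
      rw [Nat.totient_prime_pow hp hn]
      have : (1 : ℝ) < p := by exact_mod_cast hp.one_lt
      have h' : (p : ℝ) - 1 ≠ 0 := by linarith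
      obtain ⟨m, rfl⟩ : ∃ m, n = m + 1 := ⟨n - 1, by omega⟩
      push_cast [Nat.cast_sub hp.one_lt.le]
      try simp only [Nat.add_sub_cancel]
      field_simp
      ring
    rw [h1]
    refine le_trans (le_of_eq ?_) (aux_local k n p hk hp.two_le)
    refine Finset.sum_congr rfl fun j _ => ?_
    rw [gFun_apply k (pow_ne_zero _ hp.ne_zero)]
    rcases Nat.eq_zero_or_pos j with rfl | hj
    · have : (k - 1) / k = 0 := Nat.div_eq_of_lt (by omega)
      simp [this]
    · rw [Nat.primeFactors_prime_pow hj.ne' hp, Finset.prod_singleton]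
      simp [hp.factorization]
  | coprime a b ha hb hab iha ihb =>
    have hm := (gFun_mult k).mul ArithmeticFunction.isMultiplicative_zeta.natCast
    have e := hm.map_mul_of_coprime hab
    simp only [ArithmeticFunction.coe_mul_zeta_apply] at e
    rw [e, Nat.totient_mul hab]
    push_cast
    rw [← div_mul_div_comm, mul_pow]
    gcongr
    · refine Finset.sum_nonneg fun t ht => ?_
      rw [gFun_apply k (Nat.pos_of_mem_divisors ht).ne']; positivity
    · exact iha (by omega)
    · exact ihb (by omega)

open Real Finset in
lemma aux_mertens (N : ℕ) (hN : 1 ≤ N) :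
    ∑ p ∈ Nat.primesLE N, log p / p ≤ log N + log 4 := by
  have hN' : (0 : ℝ) < N := by exact_mod_cast hN
  have hth : ∑ p ∈ Nat.primesLE N, log (p : ℝ) ≤ log 4 * N := by
    rw [← Chebyshev.theta_eq_sum_primesLE_log]
    exact Chebyshev.theta_le_log4_mul_x hN'.le
  have h1 : log (N.factorial : ℝ) ≤ N * log N := by
    rw [← Real.log_pow]
    apply Real.log_le_log (by exact_mod_cast N.factorial_pos)
    exact_mod_cast Nat.factorial_le_pow N
  have h2 : ∑ p ∈ Nat.primesLE N, ((N / p : ℕ) : ℝ) * log p ≤ log (N.factorial : ℝ) := by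
    rw [Real.log_nat_eq_sum_factorization, Finsupp.sum]
    have hsub : Nat.primesLE N ⊆ N.factorial.factorization.support := by
      intro p hp
      rw [Nat.mem_primesLE] at hp
      simp only [Nat.support_factorization, Nat.mem_primeFactors]
      exact ⟨hp.2, (hp.2.dvd_factorial).2 hp.1, N.factorial_ne_zero⟩
    refine le_trans (Finset.sum_le_sum fun p hp => ?_)
      (Finset.sum_le_sum_of_subset_of_nonneg hsub ?_)
    · rw [Nat.mem_primesLE] at hp
      gcongr
      rw [Nat.factorization_factorial hp.2 (Nat.lt_succ_self _)]
      have hl : 1 ∈ Finset.Ico 1 (Nat.log p N).succ := by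
        simp only [Finset.mem_Ico, le_refl, true_and, Nat.lt_succ_iff]
        exact Nat.log_pos hp.2.one_lt hp.1
      simpa using Finset.single_le_sum (f := fun i => N / p ^ i) (fun _ _ => Nat.zero_le _) hl
    · intros; positivity
  have h3 : ∑ p ∈ Nat.primesLE N, ((N : ℝ) * (log p / p) - log p) ≤
      ∑ p ∈ Nat.primesLE N, ((N / p : ℕ) : ℝ) * log p := by
    refine Finset.sum_le_sum fun p hp => ?_
    rw [Nat.mem_primesLE] at hp
    have h0 : (0 : ℝ) ≤ log p := by positivity
    have : (N : ℝ) / p - 1 ≤ ((N / p : ℕ) : ℝ) := by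
      have := Nat.lt_floor_add_one ((N : ℝ) / p)
      rw [Nat.floor_div_eq_div] at this
      linarith
    calc _ = ((N : ℝ) / p - 1) * log p := by ring
      _ ≤ _ := by gcongr
  rw [Finset.sum_sub_distrib, ← Finset.mul_sum] at h3
  have : (N : ℝ) * ∑ p ∈ Nat.primesLE N, log (p : ℝ) / p ≤ N * (log N + log 4) := by linarith
  exact le_of_mul_le_mul_left this hN'

open Real in
lemma aux_log (r : ℕ) (hr : 1 ≤ r) : 2 ≤ log (10 * r) := by
  have hr' : (1 : ℝ) ≤ r := by exact_mod_cast hr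
  have h8 : log (8 : ℝ) = 3 * log 2 := by
    rw [show (8 : ℝ) = 2 ^ 3 by norm_num, Real.log_pow]; norm_num
  have := Real.log_two_gt_d9
  have : log (8 : ℝ) ≤ log (10 * r) := Real.log_le_log (by norm_num) (by linarith)
  linarith

open Real Finset in
lemma aux_sum (r : ℕ) (hr : 1 ≤ r) :
    ∑ p ∈ r.primeFactors, log p / p ≤ log (log (10 * r)) + log 4 + 1 := by
  have hr' : (1 : ℝ) ≤ r := by exact_mod_cast hr
  have hy := aux_log r hr
  set y := log (10 * r) with hydef
  have hfl : 1 ≤ ⌊y⌋₊ := Nat.le_floor (by push_cast; linarith)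
  have hM := aux_mertens ⌊y⌋₊ hfl
  have hlog : log (⌊y⌋₊ : ℝ) ≤ log y :=
    Real.log_le_log (by exact_mod_cast hfl) (Nat.floor_le (by linarith))
  have h1 : ∑ p ∈ r.primeFactors, log (p : ℝ) / p ≤
      ∑ p ∈ r.primeFactors, ((if p ≤ ⌊y⌋₊ then log (p : ℝ) / p else 0) + log p / y) := by
    refine Finset.sum_le_sum fun p hp => ?_
    have h0 : (0 : ℝ) ≤ log p := by positivity
    split_ifs with h
    · have : 0 ≤ log (p : ℝ) / y := div_nonneg h0 (by linarith)
      linarith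
    · have : y < p := (Nat.floor_lt (by linarith)).1 (not_le.1 h)
      rw [zero_add]
      gcongr
  have h2 : ∑ p ∈ r.primeFactors, (if p ≤ ⌊y⌋₊ then log (p : ℝ) / p else 0) ≤
      ∑ p ∈ Nat.primesLE ⌊y⌋₊, log (p : ℝ) / p := by
    rw [← Finset.sum_filter]
    apply Finset.sum_le_sum_of_subset_of_nonneg
    · intro p hp
      rw [Finset.mem_filter] at hp
      rw [Nat.mem_primesLE]
      exact ⟨hp.2, Nat.prime_of_mem_primeFactors hp.1⟩
    · intros; positivity
  have h3 : ∑ p ∈ r.primeFactors, log (p : ℝ) ≤ y := by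
    have e : ∑ p ∈ r.primeFactors, log (p : ℝ) = log ((∏ p ∈ r.primeFactors, p : ℕ) : ℝ) := by
      push_cast
      rw [Real.log_prod]
      intro p hp
      exact_mod_cast (Nat.prime_of_mem_primeFactors hp).ne_zero
    rw [e]
    have hle : (∏ p ∈ r.primeFactors, p) ≤ r := Nat.le_of_dvd hr (Nat.prod_primeFactors_dvd r)
    apply Real.log_le_log
    · exact_mod_cast Finset.prod_pos fun p hp => (Nat.prime_of_mem_primeFactors hp).pos
    · have : ((∏ p ∈ r.primeFactors, p : ℕ) : ℝ) ≤ r := by exact_mod_cast hle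
      linarith
  rw [Finset.sum_add_distrib, ← Finset.sum_div] at h1
  have h4 : (∑ p ∈ r.primeFactors, log (p : ℝ)) / y ≤ 1 := by
    rw [div_le_one (by linarith)]; exact h3
  linarith

lemma aux_zeta (s : ℝ) (hs : 1 < s) (P : Finset ℕ) (hP : ∀ p ∈ P, p.Prime) :
    ∏ p ∈ P, (1 - (p : ℝ) ^ (-s))⁻¹ ≤ 1 + 1 / (s - 1) := by
  let f : ℕ →* ℝ :=
    { toFun := fun n => (n : ℝ) ^ (-s)
      map_one' := by simp
      map_mul' := fun m n => by
        push_cast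
        exact Real.mul_rpow (Nat.cast_nonneg _) (Nat.cast_nonneg _) }
  have hf : ∀ n, f n = (n : ℝ) ^ (-s) := fun n => rfl
  have hsum : Summable f := by
    have := Real.summable_nat_rpow (p := -s)
    exact this.2 (by linarith)
  have h1 := EulerProduct.prod_filter_prime_geometric_eq_tsum_factoredNumbers hsum P
  rw [Finset.filter_true_of_mem hP] at h1
  have h2 : ∑' m : Nat.factoredNumbers P, f m ≤ ∑' n, f n :=
    hsum.tsum_subtype_le _ _ (fun n => by rw [hf]; positivity)
  have h3 : ∑' n, f n = ∑' n : ℕ, 1 / (n + 1 : ℝ) ^ s := by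
    rw [hsum.tsum_eq_zero_add, hf 0]
    rw [Nat.cast_zero, Real.zero_rpow (by linarith), zero_add]
    refine tsum_congr fun n => ?_
    rw [hf, Real.rpow_neg (by positivity)]
    push_cast
    rw [one_div]
  have h4 := ZetaAsymptotics.zeta_limit_aux1 hs
  have h5 : 0 ≤ ZetaAsymptotics.termTSum s :=
    tsum_nonneg fun n => ZetaAsymptotics.term_nonneg _ _
  have h6 : 0 ≤ s * ZetaAsymptotics.termTSum s := mul_nonneg (by linarith) h5
  calc _ = ∏ p ∈ P, (1 - f p)⁻¹ := rfl
    _ ≤ _ := by linarith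

open Real in
lemma aux_ratio (p : ℕ) (hp : 2 ≤ p) (L : ℝ) (hL : 0 < L) :
    (1 - (p : ℝ)⁻¹)⁻¹ ≤ (1 - (p : ℝ) ^ (-(1 + 1 / L)))⁻¹ * exp (2 / L * (log p / p)) := by
  have hp' : (2 : ℝ) ≤ p := by exact_mod_cast hp
  have hp0 : (0 : ℝ) < p := by linarith
  set u : ℝ := (p : ℝ)⁻¹ with hu
  have hu0 : 0 < u := by positivity
  have hu2 : u ≤ 1 / 2 := by rw [hu, inv_le_comm₀ hp0 (by norm_num)]; norm_num; exact hp
  have hv : (p : ℝ) ^ (-(1 + 1 / L)) = u * exp (-(log p / L)) := by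
    rw [neg_add, Real.rpow_add hp0, Real.rpow_neg_one, Real.rpow_def_of_pos hp0]
    congr 2; ring
  rw [hv]
  have he : 1 - log p / L ≤ exp (-(log p / L)) := by
    have := Real.add_one_le_exp (-(log p / L)); linarith
  have he1 : exp (-(log p / L)) ≤ 1 := by
    rw [Real.exp_le_one_iff]
    have : 0 ≤ log (p : ℝ) / L := by positivity
    linarith
  set E := exp (-(log p / L))
  have hE0 : 0 ≤ E := (Real.exp_pos _).le
  have hden : 0 < 1 - u * E := by nlinarith
  have hX := Real.add_one_le_exp (2 / L * (log p / p))
  have hW : 2 / L * (log p / p) = 2 * (u * (log p / L)) := by rw [hu]; field_simp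
  rw [hW] at hX ⊢
  set w := log (p : ℝ) / L
  have hw : 0 ≤ w := by positivity
  rw [← div_eq_inv_mul, inv_le_comm₀ (by linarith) (by positivity), inv_div,
    div_le_iff₀ (by positivity)]
  have a1 : (1 - u) * (2 * (u * w) + 1) ≤ (1 - u) * exp (2 * (u * w)) := by
    gcongr; linarith
  have a2 : u * (1 - w) ≤ u * E := by gcongr
  have a3 : 0 ≤ (1 - 2 * u) * (u * w) := mul_nonneg (by linarith) (by positivity)
  nlinarith

open Real in
lemma aux_second : ∃ C > 0, ∀ r : ℕ, 1 ≤ r →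
    ((r : ℝ) / (Nat.totient r : ℝ)) ≤ C * log (log (10 * r)) := by
  refine ⟨3 * exp (2 * (1 + 2 * (log 4 + 1))), by positivity, fun r hr => ?_⟩
  have hy := aux_log r hr
  have hS := aux_sum r hr
  have hL : 1 / 2 ≤ log (log (10 * r)) := by
    have := Real.log_two_gt_d9
    have := Real.log_le_log (by norm_num) hy
    linarith
  set L := log (log (10 * r))
  have hL0 : 0 < L := by linarith
  have hr0 : (r : ℝ) ≠ 0 := by positivity
  have htot : (r : ℝ) / (Nat.totient r : ℝ) = ∏ p ∈ r.primeFactors, (1 - (p : ℝ)⁻¹)⁻¹ := by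
    have h := congrArg (fun q : ℚ => (q : ℝ)) (Nat.totient_eq_mul_prod_factors r)
    push_cast at h
    rw [h, Finset.prod_inv_distrib, div_mul_cancel_left₀ hr0]
  have hz := aux_zeta (1 + 1 / L) (by have : 0 < 1 / L := by positivity
                                      linarith) r.primeFactors
    (fun p hp => Nat.prime_of_mem_primeFactors hp)
  have hz' : 1 + 1 / (1 + 1 / L - 1) = 1 + L := by rw [add_sub_cancel_left]; simp
  rw [hz'] at hz
  have hq : (log 4 + 1) / L ≤ 2 * (log 4 + 1) := by
    have h4 : 0 ≤ log (4 : ℝ) := by positivity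
    rw [div_le_iff₀ hL0]; nlinarith
  rw [htot]
  calc _ ≤ ∏ p ∈ r.primeFactors,
        ((1 - (p : ℝ) ^ (-(1 + 1 / L)))⁻¹ * exp (2 / L * (log p / p))) := by
        apply Finset.prod_le_prod
        · intro p hp
          have : (1 : ℝ) ≤ p := by exact_mod_cast (Nat.prime_of_mem_primeFactors hp).one_lt.le
          have := inv_le_one_of_one_le₀ this
          exact inv_nonneg.2 (by linarith)
        · intro p hp
          exact aux_ratio p (Nat.prime_of_mem_primeFactors hp).two_le L hL0
    _ = (∏ p ∈ r.primeFactors, (1 - (p : ℝ) ^ (-(1 + 1 / L)))⁻¹) *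
        exp (2 / L * ∑ p ∈ r.primeFactors, log p / p) := by
        rw [Finset.prod_mul_distrib, ← Real.exp_sum, Finset.mul_sum]
    _ ≤ (3 * L) * exp (2 * (1 + 2 * (log 4 + 1))) := by
        refine mul_le_mul (by linarith) (Real.exp_le_exp.2 ?_) (Real.exp_pos _).le (by linarith)
        · calc _ ≤ 2 / L * (L + log 4 + 1) := by gcongr
            _ = 2 * (1 + (log 4 + 1) / L) := by field_simp; ring
            _ ≤ _ := by gcongr
    _ = _ := by ring


/-- For fixed k ≥ 1 there is C (depending on k) with
∑_{t ∣ r} 1/f_t ≤ (r/φ(r))^k ≤ C (log log(10r))^k for all r ≥ 1,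
where f_t = ∏ p^{⌈v_p(t)/k⌉}. -/
theorem stmt_10 (k : ℕ) (hk : 1 ≤ k) :
    ∃ C > 0, ∀ r : ℕ, 1 ≤ r →
      (∑ t ∈ r.divisors,
          (1 : ℝ) / (∏ p ∈ t.primeFactors, p ^ ((t.factorization p + k - 1) / k) : ℕ)) ≤
        ((r : ℝ) / (Nat.totient r : ℝ)) ^ k ∧
      ((r : ℝ) / (Nat.totient r : ℝ)) ^ k ≤ C * (Real.log (Real.log (10 * r))) ^ k := by
  obtain ⟨C, hC, h⟩ := aux_second
  refine ⟨C ^ k, by positivity, fun r hr => ⟨?_, ?_⟩⟩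
  · refine le_trans (le_of_eq ?_) (aux_first k hk r (by omega))
    refine Finset.sum_congr rfl fun t ht => ?_
    rw [gFun_apply k (Nat.pos_of_mem_divisors ht).ne']
  · rw [← mul_pow]
    have := h r hr
    gcongr
end

section
/- Let c be a positive integer and k, l integers with gcd(k, c) = 1. Then |∑_{d=1}^{c} e((k d³ + l d)/c)| ≤ C c^{1/2+ε} gcd(l, c) for a constant C depending only on ε > 0, where e(x) = e^{2πi x}. Moreover, |∑_{d=1}^{c} e(k d³ / c)| ≤ C c^{2/3}. -/
open Polynomial in
lemma hua_stepanov (p : ℕ) [Fact p.Prime] (hp : 5 ≤ p) (K : Type) [Field K] [Fintype K]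
    [Algebra (ZMod p) K] (ν : ℕ) (hcard : Fintype.card K = (p ^ (ν + 1)) ^ 2)
    (k l : ZMod p) (hk : k ≠ 0) (b : ZMod p) (s : Finset K)
    (hs : ∀ x ∈ s, Algebra.trace (ZMod p) K
      (algebraMap (ZMod p) K k * x ^ 3 + algebraMap (ZMod p) K l * x) = b) :
    s.card ≤ p ^ ν * p ^ (ν + 1) + 8 * p ^ (ν + 1) := by
  classical
  have hpp : p.Prime := Fact.out
  have : CharP K p := charP_of_injective_algebraMap (algebraMap (ZMod p) K).injective p
  set I := p ^ ν with hI
  set Q := p ^ (ν + 1) with hQ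
  have hQI : Q = p * I := by rw [hQ, hI, pow_succ]; ring
  have hI1 : 1 ≤ I := Nat.one_le_pow _ _ hpp.pos
  set J := I + 5 with hJ
  set κ := algebraMap (ZMod p) K k with hκ
  set lam := algebraMap (ZMod p) K l with hlam
  have hκ0 : κ ≠ 0 := by
    rw [hκ]; simpa using hk
  set f : K[X] := C κ * X ^ 3 + C lam * X with hf
  set g : K[X] := ∑ i ∈ Finset.range (ν + 1), f ^ (p ^ i) with hg
  have hfdeg : f.natDegree = 3 := by
    rw [hf]; compute_degree!
  have hf0 : f ≠ 0 := by
    intro h; rw [h] at hfdeg; simp at hfdeg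
  have hgdeg : g.natDegree = 3 * I := by
    rw [hg, Finset.sum_range_succ]
    rw [natDegree_add_eq_right_of_natDegree_lt]
    · rw [natDegree_pow, hfdeg, hI]; ring
    · rw [natDegree_pow, hfdeg]
      refine lt_of_le_of_lt (natDegree_sum_le_of_forall_le (n := (p ^ ν - 1) * 3) _ _ ?_) ?_
      · intro i hi
        rw [natDegree_pow, hfdeg]
        have : p ^ i < p ^ ν := Nat.pow_lt_pow_right hpp.one_lt (Finset.mem_range.1 hi)
        exact Nat.mul_le_mul_right _ (by omega)
      · have : 1 ≤ p ^ ν := hI1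
        omega
  have hg0 : g ≠ 0 := by
    intro h; rw [h] at hgdeg; simp at hgdeg; omega
  have hfrob : ∀ x : K, x ^ (Q ^ 2) = x := by
    intro x; rw [← hcard]; exact FiniteField.pow_card x
  have hfin : Module.finrank (ZMod p) K = (ν + 1) + (ν + 1) := by
    have h1 : Fintype.card K = p ^ Module.finrank (ZMod p) K := by
      have := Module.card_eq_pow_finrank (K := ZMod p) (V := K)
      rwa [ZMod.card] at this
    rw [hcard, hQ, ← pow_mul] at h1
    have := Nat.pow_right_injective hpp.two_le h1
    omega
  -- the key relation on the set
  have hrel : ∀ x ∈ s, (g.eval x) ^ Q = algebraMap (ZMod p) K b - g.eval x := by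
    intro x hx
    have h1 := FiniteField.algebraMap_trace_eq_sum_pow (ZMod p) K (κ * x ^ 3 + lam * x)
    rw [hs x hx, hfin, Finset.sum_range_add] at h1
    have h2 : g.eval x = ∑ i ∈ Finset.range (ν + 1), (κ * x ^ 3 + lam * x) ^ (p ^ i) := by
      rw [hg, eval_finsetSum]; simp [hf]
    have h3 : (g.eval x) ^ Q = ∑ i ∈ Finset.range (ν + 1),
        (κ * x ^ 3 + lam * x) ^ (p ^ (ν + 1 + i)) := by
      rw [h2, hQ, sum_pow_char_pow]
      refine Finset.sum_congr rfl fun i _ => ?_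
      rw [← pow_mul, ← pow_add, add_comm i]
    rw [h3, h2, h1]
    simp only [Nat.card_eq_fintype_card, ZMod.card]
    ring
  -- linear dependence
  let ι := Fin I × Fin J × Fin p
  let t : ι → K[X] := fun i => X ^ ((i.1 : ℕ) + (i.2.1 : ℕ) * Q) * g ^ (i.2.2 : ℕ)
  let r : ι → K[X] := fun i =>
    X ^ ((i.1 : ℕ) * Q + (i.2.1 : ℕ)) * (C (algebraMap (ZMod p) K b) - g) ^ (i.2.2 : ℕ)
  have hrdeg : ∀ i, r i ∈ degreeLT K (I * Q + 4 * Q) := by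
    rintro ⟨i, j, m⟩
    rw [mem_degreeLT]
    have h1 : (C (algebraMap (ZMod p) K b) - g).natDegree ≤ 3 * I := by
      refine (natDegree_sub_le _ _).trans ?_
      simp [hgdeg]
    have h2 : (r ⟨i, j, m⟩).natDegree ≤ ((i : ℕ) * Q + (j : ℕ)) + m * (3 * I) := by
      refine (natDegree_mul_le).trans ?_
      refine add_le_add ?_ ?_
      · simp
      · exact (natDegree_pow_le).trans (Nat.mul_le_mul_left _ h1)
    refine lt_of_le_of_lt degree_le_natDegree ?_
    rw [Nat.cast_lt]
    refine lt_of_le_of_lt h2 ?_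
    have hi := i.2; have hj := j.2; have hm := m.2
    have e1 : (i : ℕ) * Q + Q ≤ I * Q := by
      calc (i : ℕ) * Q + Q = (i + 1) * Q := by ring
        _ ≤ I * Q := Nat.mul_le_mul_right _ hi
    have e2 : (m : ℕ) * (3 * I) ≤ 3 * Q := by
      rw [hQI]
      calc (m : ℕ) * (3 * I) ≤ p * (3 * I) := Nat.mul_le_mul_right _ hm.le
        _ = _ := by ring
    have e3 : 5 * I ≤ Q := by rw [hQI]; exact Nat.mul_le_mul_right _ hp
    omega
  have hdep : ¬ LinearIndependent K (fun i => (⟨r i, hrdeg i⟩ : degreeLT K (I * Q + 4 * Q))) := by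
    intro h
    have h1 := h.fintype_card_le_finrank
    have h2 : Module.finrank K (degreeLT K (I * Q + 4 * Q)) = I * Q + 4 * Q := by
      rw [(degreeLTEquiv K (I * Q + 4 * Q)).finrank_eq]; simp
    rw [h2] at h1
    simp only [ι, Fintype.card_prod, Fintype.card_fin] at h1
    have h3 : I * (J * p) = I * Q + 5 * Q := by rw [hQI, hJ]; ring
    have : 0 < Q := by rw [hQI]; positivity
    omega
  rw [Fintype.not_linearIndependent_iff] at hdep
  obtain ⟨a, ha, i0, hi0⟩ := hdep
  have ha' : ∑ i, C (a i) * r i = 0 := by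
    have := congrArg (Submodule.subtype _) ha
    simp only [map_sum, map_smul, Submodule.subtype_apply, map_zero] at this
    simpa [smul_eq_C_mul] using this
  let P : K[X] := ∑ i, C (a i ^ Q) * t i
  have htdeg : ∀ i : ι, (t i).natDegree = (i.1 : ℕ) + (i.2.1 : ℕ) * Q + (i.2.2 : ℕ) * (3 * I) := by
    intro i
    simp only [t]
    rw [natDegree_mul (pow_ne_zero _ X_ne_zero) (pow_ne_zero _ hg0), natDegree_pow, natDegree_pow,
      hgdeg, natDegree_X, mul_one]
  have ht0 : ∀ i, t i ≠ 0 := fun i => mul_ne_zero (pow_ne_zero _ X_ne_zero) (pow_ne_zero _ hg0)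
  have htinj : ∀ i j : ι, (t i).natDegree = (t j).natDegree → i = j := by
    rintro ⟨i, j, m⟩ ⟨i', j', m'⟩ h
    rw [htdeg, htdeg] at h
    simp only [hQI] at h
    have hh : (i : ℕ) + I * (j * p + 3 * m) = i' + I * (j' * p + 3 * m') := by linarith
    have h1 : (i : ℕ) = i' := by
      have := congrArg (· % I) hh
      simpa [Nat.mod_eq_of_lt i.2, Nat.mod_eq_of_lt i'.2] using this
    have h2 : (j * p + 3 * m : ℕ) = j' * p + 3 * m' := by
      rw [h1] at hh
      exact Nat.eq_of_mul_eq_mul_left hI1 (Nat.add_left_cancel hh)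
    have h3 : (m : ℕ) = m' := by
      have h4 : 3 * (m : ℕ) ≡ 3 * m' [MOD p] := by
        have := congrArg (· % p) h2
        simpa [Nat.ModEq, Nat.add_mod, Nat.mul_mod] using this
      have h5 : Nat.gcd p 3 = 1 := by
        rw [← Nat.coprime_iff_gcd_eq_one, Nat.coprime_primes hpp Nat.prime_three]; omega
      have h6 := Nat.ModEq.cancel_left_of_coprime h5 h4
      exact Nat.ModEq.eq_of_lt_of_lt h6 m.2 m'.2
    have h4 : (j : ℕ) = j' := by
      rw [h3] at h2
      exact Nat.eq_of_mul_eq_mul_right hpp.pos (Nat.add_right_cancel h2)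
    ext <;> simp [h1, h3, h4]
  have hP0 : P ≠ 0 := by
    intro h
    have h1 := degree_sum_eq_of_disjoint (fun i => C (a i ^ Q) * t i) Finset.univ (by
      intro i hi j hj hij heq
      simp only [Set.mem_ofPred_eq, ne_eq, mul_eq_zero, C_eq_zero, not_or] at hi hj
      simp only [Function.comp] at heq
      rw [degree_C_mul hi.2.1, degree_C_mul hj.2.1] at heq
      exact hij (htinj i j (natDegree_eq_of_degree_eq heq)))
    have h2 : (∑ i, C (a i ^ Q) * t i) = 0 := h
    rw [h2, degree_zero] at h1
    have h3 := Finset.le_sup (f := fun i => degree (C (a i ^ Q) * t i)) (Finset.mem_univ i0)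
    rw [← h1] at h3
    simp only [le_bot_iff, degree_eq_bot, mul_eq_zero, C_eq_zero] at h3
    rcases h3 with h3 | h3
    · exact hi0 (pow_eq_zero_iff (by positivity : Q ≠ 0) |>.1 h3)
    · exact ht0 _ h3
  have hPdeg : P.natDegree ≤ I * Q + 8 * Q := by
    refine natDegree_sum_le_of_forall_le _ _ ?_
    rintro ⟨i, j, m⟩ -
    refine (natDegree_C_mul_le _ _).trans ?_
    rw [htdeg]
    have hi := i.2; have hj := j.2; have hm := m.2
    simp only
    have e1 : (j : ℕ) * Q + Q ≤ (I + 5) * Q := by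
      calc (j : ℕ) * Q + Q = (j + 1) * Q := by ring
        _ ≤ _ := Nat.mul_le_mul_right _ hj
    have e2 : (m : ℕ) * (3 * I) ≤ 3 * Q := by
      rw [hQI]
      calc (m : ℕ) * (3 * I) ≤ p * (3 * I) := Nat.mul_le_mul_right _ hm.le
        _ = _ := by ring
    have e3 : 5 * I ≤ Q := by rw [hQI]; exact Nat.mul_le_mul_right _ hp
    have e4 : (I + 5) * Q = I * Q + 5 * Q := by ring
    omega
  have hroot : ∀ x ∈ s, P.eval x = 0 := by
    intro x hx
    have h1 : (P.eval x) ^ Q = (∑ i, C (a i) * r i).eval x := by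
      simp only [P]
      rw [eval_finsetSum, eval_finsetSum, hQ, sum_pow_char_pow, ← hQ]
      refine Finset.sum_congr rfl fun i _ => ?_
      simp only [t, r, eval_mul, eval_C, eval_pow, eval_X, eval_sub]
      rw [mul_pow, mul_pow, ← pow_mul, ← sq, hfrob, ← hrel x hx]
      congr 2
      · rw [← pow_mul, add_mul, pow_add, pow_add, mul_assoc, ← sq, mul_comm (i.2.1 : ℕ) (Q ^ 2),
          pow_mul x (Q ^ 2), hfrob]
      · rw [← pow_mul, ← pow_mul, mul_comm]
    rw [ha'] at h1
    simp only [eval_zero] at h1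
    exact pow_eq_zero_iff (by positivity : Q ≠ 0) |>.1 h1
  exact (card_le_degree_of_subset_roots (p := P) (by
    intro x hx
    rw [Finset.mem_val] at hx
    exact (mem_roots hP0).2 (hroot x hx))).trans hPdeg

/-- The cubic exponential sum over a finite extension of `ZMod p`. -/
noncomputable def huaSum (p : ℕ) [Fact p.Prime] (K : Type) [Field K] [Fintype K]
    [Algebra (ZMod p) K] (k l : ZMod p) : ℂ :=
  ∑ x : K, ZMod.stdAddChar (Algebra.trace (ZMod p) K
      (algebraMap (ZMod p) K k * x ^ 3 + algebraMap (ZMod p) K l * x))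

lemma hua_norm_addChar {n : ℕ} [NeZero n] (x : ZMod n) : ‖ZMod.stdAddChar x‖ = 1 := by
  rw [ZMod.stdAddChar_apply]; exact Circle.norm_coe _

lemma huaSum_le (p : ℕ) [Fact p.Prime] (hp : 5 ≤ p) (K : Type) [Field K] [Fintype K]
    [Algebra (ZMod p) K] (ν : ℕ) (hcard : Fintype.card K = (p ^ (ν + 1)) ^ 2)
    (k l : ZMod p) (hk : k ≠ 0) :
    ‖huaSum p K k l‖ ≤ 8 * p * p ^ (ν + 1) := by
  classical
  set T : K → ZMod p := fun x => Algebra.trace (ZMod p) K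
      (algebraMap (ZMod p) K k * x ^ 3 + algebraMap (ZMod p) K l * x) with hT
  set N : ZMod p → ℝ := fun b => ((Finset.univ.filter fun x => T x = b).card : ℝ) with hN
  set B : ℝ := p ^ ν * p ^ (ν + 1) + 8 * p ^ (ν + 1) with hB
  have hNB : ∀ b, N b ≤ B := by
    intro b
    have := hua_stepanov p hp K ν hcard k l hk b (Finset.univ.filter fun x => T x = b) (by simp [T])
    simp only [hN, hB]; exact_mod_cast this
  have h1 : huaSum p K k l = ∑ b : ZMod p, (N b : ℂ) * ZMod.stdAddChar b := by
    unfold huaSum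
    rw [← Finset.sum_fiberwise (s := Finset.univ) (g := T)]
    refine Finset.sum_congr rfl fun b _ => ?_
    rw [Finset.sum_congr rfl (g := fun _ => ZMod.stdAddChar b)]
    · simp [hN]
    · intro x hx
      rw [← (Finset.mem_filter.1 hx).2]
  have h2 : ∑ b : ZMod p, (ZMod.stdAddChar b : ℂ) = 0 := by
    have := AddChar.sum_mulShift (1 : ZMod p) (ZMod.isPrimitive_stdAddChar p)
    simpa using this
  have h3 : huaSum p K k l = ∑ b : ZMod p, ((N b - B : ℝ) : ℂ) * ZMod.stdAddChar b := by
    rw [h1]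
    push_cast
    simp only [sub_mul]
    rw [Finset.sum_sub_distrib, ← Finset.mul_sum, h2]; simp
  have h4 : ∑ b, N b = (p ^ (ν + 1)) ^ 2 := by
    have := Finset.card_eq_sum_card_fiberwise (s := (Finset.univ : Finset K)) (t := Finset.univ)
      (f := T) (by intro x _; simp)
    rw [Finset.card_univ, hcard] at this
    simp only [hN]; exact_mod_cast this.symm
  rw [h3]
  refine (norm_sum_le _ _).trans ?_
  have h5 : ∀ b : ZMod p, ‖((N b - B : ℝ) : ℂ) * ZMod.stdAddChar b‖ = B - N b := by
    intro b
    rw [norm_mul, hua_norm_addChar, mul_one, Complex.norm_real, Real.norm_eq_abs,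
      abs_of_nonpos (by linarith [hNB b])]
    ring
  simp only [h5]
  rw [Finset.sum_sub_distrib, h4]
  simp only [Finset.sum_const, Finset.card_univ, ZMod.card, nsmul_eq_mul, hB]
  apply le_of_eq
  ring

lemma hua_sum_squares (K : Type) [Field K] [Fintype K] (hK : ringChar K ≠ 2) (d : K)
    (hd : ¬ IsSquare d) (F : K → ℂ) :
    ∑ b : K, (F (b ^ 2) + F (d * b ^ 2)) = 2 * ∑ t : K, F t := by
  classical
  have key : ∀ e : K, e ≠ 0 → ∑ b : K, F (e * b ^ 2)
      = ∑ t : K, ((quadraticChar K (e⁻¹ * t) + 1 : ℤ) : ℂ) * F t := by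
    intro e he
    rw [← Finset.sum_fiberwise (s := Finset.univ) (g := fun b : K => e * b ^ 2)]
    refine Finset.sum_congr rfl fun t _ => ?_
    rw [Finset.sum_congr rfl (g := fun _ => F t)]
    · rw [Finset.sum_const, nsmul_eq_mul]
      congr 1
      rw [← quadraticChar_card_sqrts hK]
      rw [Int.cast_natCast]
      congr 2
      ext b
      simp only [Finset.mem_filter, Finset.mem_univ, true_and, Set.mem_toFinset, Set.mem_ofPred_eq]
      constructor
      · rintro rfl; field_simp
      · intro h; rw [h]; field_simp
    · intro x hx
      rw [← (Finset.mem_filter.1 hx).2]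
  have hd0 : d ≠ 0 := by rintro rfl; exact hd (IsSquare.zero)
  have k1 := key 1 one_ne_zero
  have k2 := key d hd0
  simp only [one_mul, inv_one] at k1
  rw [Finset.sum_add_distrib, k1, k2, ← Finset.sum_add_distrib, Finset.mul_sum]
  refine Finset.sum_congr rfl fun t _ => ?_
  have h1 : quadraticChar K (d⁻¹ * t) = - quadraticChar K t := by
    rw [map_mul]
    have : quadraticChar K d⁻¹ = -1 := by
      rw [quadraticChar_neg_one_iff_not_isSquare]
      intro h; apply hd; simpa using h.inv
    rw [this]; ring
  rw [h1]; push_cast; ring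

lemma hua_quad_re {K : Type} [Field K] (d κ lam a b : K) :
    (algebraMap K (QuadraticAlgebra K d 0) κ * (⟨a, b⟩ : QuadraticAlgebra K d 0) ^ 3
      + algebraMap K (QuadraticAlgebra K d 0) lam * (⟨a, b⟩ : QuadraticAlgebra K d 0)).re
      = κ * a ^ 3 + lam * a + 3 * κ * a * (d * b ^ 2) := by
  simp [pow_succ]
  ring

/-- The quadratic extension relation. -/
lemma huaSum_quad (p : ℕ) [Fact p.Prime] (hp : 5 ≤ p) (K : Type) [Field K] [Fintype K]
    [Algebra (ZMod p) K] (k l : ZMod p) (hk : k ≠ 0) :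
    ∃ (L : Type) (_ : Field L) (_ : Fintype L) (_ : Algebra (ZMod p) L),
      Fintype.card L = Fintype.card K ^ 2 ∧
      huaSum p L k l = 2 * Fintype.card K - huaSum p K k l ^ 2 := by
  classical
  have : CharP K p := charP_of_injective_algebraMap (algebraMap (ZMod p) K).injective p
  have hchar : ringChar K = p := ringChar.eq K p ▸ rfl
  have hK2 : ringChar K ≠ 2 := by rw [hchar]; omega
  obtain ⟨d, hd⟩ := FiniteField.exists_nonsquare hK2
  have hfact : Fact (∀ r : K, r ^ 2 ≠ d + 0 * r) := ⟨fun r hr => hd ⟨r, by rw [← sq, hr]; ring⟩⟩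
  let L := QuadraticAlgebra K d 0
  let e : L ≃ K × K := QuadraticAlgebra.equivProd d 0
  let hLF : Fintype L := Fintype.ofEquiv _ e.symm
  refine ⟨L, inferInstance, hLF, inferInstance, ?_, ?_⟩
  · rw [Fintype.card_congr e, Fintype.card_prod, sq]
  set κ := algebraMap (ZMod p) K k with hκ
  set lam := algebraMap (ZMod p) K l with hlam
  have hκ0 : κ ≠ 0 := by rw [hκ]; simpa using hk
  set χ : AddChar K ℂ := ZMod.stdAddChar.compAddMonoidHom
    (Algebra.trace (ZMod p) K).toAddMonoidHom with hχ
  have hχa : ∀ x, χ x = ZMod.stdAddChar (Algebra.trace (ZMod p) K x) := fun x => rfl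
  have hχprim : χ.IsPrimitive := by
    apply AddChar.IsPrimitive.of_ne_one
    intro h
    obtain ⟨b, hb⟩ := Algebra.trace_surjective (ZMod p) K 1
    have h1 : χ b = 1 := by rw [h]; rfl
    rw [hχa, hb] at h1
    have h2 := ZMod.injective_stdAddChar (h1.trans (AddChar.map_zero_eq_one _).symm)
    exact one_ne_zero h2
  have htr : ∀ z : L, Algebra.trace K L z = 2 * z.re := by
    intro z
    rw [Algebra.trace_eq_matrix_trace (QuadraticAlgebra.basis d 0), Matrix.trace_fin_two,
      Algebra.leftMulMatrix_eq_repr_mul, Algebra.leftMulMatrix_eq_repr_mul]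
    simp [QuadraticAlgebra.basis]
    ring
  have hL : huaSum p L k l = ∑ a : K, ∑ b : K,
      χ (2 * (κ * a ^ 3 + lam * a)) * χ (6 * κ * a * (d * b ^ 2)) := by
    unfold huaSum
    rw [← e.symm.sum_comp, Fintype.sum_prod_type]
    refine Finset.sum_congr rfl fun a _ => Finset.sum_congr rfl fun b _ => ?_
    rw [← AddChar.map_add_eq_mul, hχa, ← Algebra.trace_trace (S := K), htr]
    congr 2
    have e1 : (algebraMap (ZMod p) L k) = algebraMap K L κ := by
      rw [hκ, ← IsScalarTower.algebraMap_apply]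
    have e2 : (algebraMap (ZMod p) L l) = algebraMap K L lam := by
      rw [hlam, ← IsScalarTower.algebraMap_apply]
    rw [e1, e2]
    refine (congrArg (fun t => 2 * t) (hua_quad_re d κ lam a b)).trans ?_
    ring
  have h2 : (2 : K) ≠ 0 := Ring.two_ne_zero hK2
  have hcop : ∀ q : ℕ, q.Prime → q < 5 → (q : K) ≠ 0 := by
    intro q hq hq5 h
    rw [CharP.cast_eq_zero_iff K p] at h
    have := Nat.le_of_dvd hq.pos h
    omega
  have h3 : (3 : K) ≠ 0 := by simpa using hcop 3 Nat.prime_three (by norm_num)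
  have hKs : huaSum p K k l ^ 2 = ∑ a : K, ∑ b : K,
      χ (2 * (κ * a ^ 3 + lam * a)) * χ (6 * κ * a * b ^ 2) := by
    unfold huaSum
    simp only [← hχa]
    rw [sq, Finset.sum_mul_sum, ← Fintype.sum_prod_type', ← Fintype.sum_prod_type']
    symm
    refine Fintype.sum_bijective (fun x : K × K => (x.1 + x.2, x.1 - x.2)) ?_ _ _ ?_
    · rw [Finite.injective_iff_bijective.symm]
      rintro ⟨a, b⟩ ⟨a', b'⟩ h
      simp only [Prod.mk.injEq] at h
      have ha : a = a' := mul_left_cancel₀ h2 (by linear_combination h.1 + h.2)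
      have hb : b = b' := mul_left_cancel₀ h2 (by linear_combination h.1 - h.2)
      rw [ha, hb]
    · rintro ⟨a, b⟩
      rw [← AddChar.map_add_eq_mul, ← AddChar.map_add_eq_mul]
      congr 1
      ring
  rw [eq_sub_iff_add_eq, hL, hKs, ← Finset.sum_add_distrib]
  have inner : ∀ a : K, (∑ b : K, χ (2 * (κ * a ^ 3 + lam * a)) * χ (6 * κ * a * (d * b ^ 2)))
      + (∑ b : K, χ (2 * (κ * a ^ 3 + lam * a)) * χ (6 * κ * a * b ^ 2))
      = if a = 0 then 2 * (Fintype.card K : ℂ) else 0 := by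
    intro a
    rw [← Finset.mul_sum, ← Finset.mul_sum, ← mul_add, ← Finset.sum_add_distrib]
    have := hua_sum_squares K hK2 d hd (fun t => χ (6 * κ * a * t))
    simp only [add_comm (χ (6 * κ * a * (d * _)))]
    rw [this]
    have h6 := AddChar.sum_mulShift (6 * κ * a) hχprim
    simp only [mul_comm _ (6 * κ * a)] at h6
    rw [h6]
    by_cases ha : a = 0
    · subst ha; simp
    · have : 6 * κ * a ≠ 0 := by
        have : (6 : K) ≠ 0 := by
          have : (6 : K) = 2 * 3 := by norm_num
          rw [this]; exact mul_ne_zero h2 h3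
        exact mul_ne_zero (mul_ne_zero this hκ0) ha
      rw [if_neg this, if_neg ha]; simp
  rw [Finset.sum_congr rfl fun a _ => inner a]
  simp

lemma huaSum_grow (p : ℕ) [Fact p.Prime] (hp : 5 ≤ p) (k l : ZMod p) (hk : k ≠ 0) (δ : ℝ)
    (hδ : 0 ≤ δ) (h0 : (2 + δ) * Real.sqrt p ≤ ‖huaSum p (ZMod p) k l‖) (j : ℕ) :
    ∃ (L : Type) (_ : Field L) (_ : Fintype L) (_ : Algebra (ZMod p) L),
      Fintype.card L = p ^ (2 ^ j) ∧
      (2 + 4 ^ j * δ) * Real.sqrt (p ^ (2 ^ j) : ℝ) ≤ ‖huaSum p L k l‖ := by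
  induction j with
  | zero =>
    refine ⟨ZMod p, inferInstance, inferInstance, inferInstance, ?_, ?_⟩
    · simp [ZMod.card]
    · simpa using h0
  | succ j ih =>
    obtain ⟨K, i1, i2, i3, hc, hb⟩ := ih
    obtain ⟨L, j1, j2, j3, hc', hb'⟩ := huaSum_quad p hp K k l hk
    refine ⟨L, j1, j2, j3, ?_, ?_⟩
    · rw [hc', hc, ← pow_mul, pow_succ]
    · rw [hb']
      set q : ℝ := p ^ (2 ^ j) with hq
      have hq0 : 0 ≤ q := by positivity
      have e1 : (p ^ (2 ^ (j + 1)) : ℝ) = q ^ 2 := by rw [hq, ← pow_mul, pow_succ]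
      rw [e1, Real.sqrt_sq hq0]
      have e2 : ‖huaSum p K k l ^ 2‖ - ‖(2 * (Fintype.card K) : ℂ)‖
          ≤ ‖2 * (Fintype.card K : ℂ) - huaSum p K k l ^ 2‖ := by
        rw [norm_sub_rev]; exact norm_sub_norm_le _ _
      refine le_trans ?_ e2
      have e3 : ‖(2 * (Fintype.card K) : ℂ)‖ = 2 * q := by
        rw [norm_mul, Complex.norm_natCast, hc]; simp [hq]
      rw [e3, norm_pow]
      have hD : 0 ≤ 4 ^ j * δ := by positivity
      have e4 : ((2 + 4 ^ j * δ) * Real.sqrt q) ^ 2 ≤ ‖huaSum p K k l‖ ^ 2 :=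
        pow_le_pow_left₀ (by positivity) hb 2
      rw [mul_pow, Real.sq_sqrt hq0] at e4
      have e5 : (4 : ℝ) ^ (j + 1) * δ = 4 * (4 ^ j * δ) := by ring
      rw [e5]
      nlinarith [mul_nonneg (mul_nonneg hD hD) hq0]

/-- Weil's bound for cubic sums over the prime field. -/
lemma hua_weil (p : ℕ) [Fact p.Prime] (hp : 5 ≤ p) (k l : ZMod p) (hk : k ≠ 0) :
    ‖∑ x : ZMod p, ZMod.stdAddChar (k * x ^ 3 + l * x)‖ ≤ 2 * Real.sqrt p := by
  have hpp : p.Prime := Fact.out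
  have heq : ∑ x : ZMod p, ZMod.stdAddChar (k * x ^ 3 + l * x) = huaSum p (ZMod p) k l := by
    unfold huaSum; simp
  rw [heq]
  by_contra! hlt
  have hs : 0 < Real.sqrt p := Real.sqrt_pos.2 (by exact_mod_cast hpp.pos)
  set δ := ‖huaSum p (ZMod p) k l‖ / Real.sqrt p - 2 with hδ
  have hδ0 : 0 < δ := by
    rw [hδ, sub_pos, lt_div_iff₀ hs]; exact hlt
  have h0 : (2 + δ) * Real.sqrt p ≤ ‖huaSum p (ZMod p) k l‖ := by
    rw [hδ]; apply le_of_eq; field_simp; ring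
  obtain ⟨j, hj⟩ := pow_unbounded_of_one_lt (8 * p / δ) (by norm_num : (1 : ℝ) < 4)
  obtain ⟨L, i1, i2, i3, hc, hb⟩ := huaSum_grow p hp k l hk δ hδ0.le h0 (j + 1)
  have hpow : 1 ≤ 2 ^ j := Nat.one_le_two_pow
  have e0 : 2 ^ j - 1 + 1 = 2 ^ j := by omega
  have hb2 := huaSum_le p hp L (2 ^ j - 1) (by rw [hc, e0, ← pow_mul, pow_succ]) k l hk
  rw [e0] at hb2
  have e1 : (p ^ (2 ^ (j + 1)) : ℝ) = (p ^ 2 ^ j) ^ 2 := by rw [← pow_mul, pow_succ]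
  have hq : (0 : ℝ) < p ^ 2 ^ j := by have := hpp.pos; positivity
  rw [e1, Real.sqrt_sq hq.le] at hb
  have h1 := le_of_mul_le_mul_right (hb.trans hb2) hq
  rw [div_lt_iff₀ hδ0] at hj
  have : (4 : ℝ) ^ (j + 1) * δ = 4 * (4 ^ j * δ) := by ring
  have : (0 : ℝ) ≤ 4 ^ j * δ := by positivity
  linarith

/-- `e(x / c)`. -/
noncomputable def huaE (c : ℕ) (x : ℤ) : ℂ := Complex.exp (2 * Real.pi * Complex.I * (x : ℂ) / c)

/-- The complete cubic exponential sum. -/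
noncomputable def huaT (c : ℕ) (k l : ℤ) : ℂ :=
  ∑ d ∈ Finset.range c, huaE c (k * (d : ℤ) ^ 3 + l * d)

lemma huaE_eq (c : ℕ) [NeZero c] (x : ℤ) : huaE c x = ZMod.stdAddChar (x : ZMod c) := by
  rw [ZMod.stdAddChar_coe]; rfl

lemma huaE_add (c : ℕ) (x y : ℤ) : huaE c (x + y) = huaE c x * huaE c y := by
  unfold huaE; rw [← Complex.exp_add]; congr 1; push_cast; ring

lemma huaE_norm (c : ℕ) (hc : c ≠ 0) (x : ℤ) : ‖huaE c x‖ = 1 := by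
  have : NeZero c := ⟨hc⟩
  rw [huaE_eq]; exact hua_norm_addChar _

lemma huaE_congr (c : ℕ) (hc : c ≠ 0) (x y : ℤ) (h : (c : ℤ) ∣ x - y) : huaE c x = huaE c y := by
  have : NeZero c := ⟨hc⟩
  rw [huaE_eq, huaE_eq]
  congr 1
  rw [← sub_eq_zero, ← Int.cast_sub, ZMod.intCast_zmod_eq_zero_iff_dvd]; exact h

lemma huaE_mul (m n : ℕ) (hm : m ≠ 0) (x : ℤ) : huaE (m * n) (m * x) = huaE n x := by
  unfold huaE
  congr 1
  push_cast
  have : (m : ℂ) ≠ 0 := by exact_mod_cast hm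
  by_cases hn : (n : ℂ) = 0
  · simp [hn]
  · field_simp

lemma hua_sum_zmod (c : ℕ) [NeZero c] (F : ZMod c → ℂ) :
    ∑ d ∈ Finset.range c, F (d : ZMod c) = ∑ x : ZMod c, F x := by
  refine Finset.sum_bij (fun d _ => (d : ZMod c)) (by simp) ?_ ?_ (by simp)
  · intro a ha b hb h
    rw [ZMod.natCast_eq_natCast_iff'] at h
    rwa [Nat.mod_eq_of_lt (Finset.mem_range.1 ha), Nat.mod_eq_of_lt (Finset.mem_range.1 hb)] at h
  · intro x _
    exact ⟨x.val, Finset.mem_range.2 (ZMod.val_lt x), by simp⟩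

lemma huaE_geom (N : ℕ) (hN : N ≠ 0) (t : ℤ) :
    ∑ v ∈ Finset.range N, huaE N (v * t) = if (N : ℤ) ∣ t then (N : ℂ) else 0 := by
  classical
  have : NeZero N := ⟨hN⟩
  have h := hua_sum_zmod N (fun x => ZMod.stdAddChar (x * (t : ZMod N)))
  rw [AddChar.sum_mulShift _ (ZMod.isPrimitive_stdAddChar N)] at h
  simp only [ZMod.intCast_zmod_eq_zero_iff_dvd, ZMod.card] at h
  rw [← (by split_ifs <;> simp :
    ((if (N : ℤ) ∣ t then N else 0 : ℕ) : ℂ) = if (N : ℤ) ∣ t then (N : ℂ) else 0), ← h]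
  refine Finset.sum_congr rfl fun v _ => ?_
  rw [huaE_eq]; push_cast; rfl

lemma hua_split {α : Type*} [AddCommMonoid α] (M N : ℕ) (F : ℕ → α) :
    ∑ d ∈ Finset.range (M * N), F d
      = ∑ u ∈ Finset.range M, ∑ v ∈ Finset.range N, F (u + M * v) := by
  induction N with
  | zero => simp
  | succ N ih =>
    rw [Nat.mul_succ, Finset.sum_range_add, ih, ← Finset.sum_add_distrib]
    refine Finset.sum_congr rfl fun u _ => ?_
    rw [Finset.sum_range_succ, add_comm u]

lemma huaT_trivial (c : ℕ) (k l : ℤ) : ‖huaT c k l‖ ≤ c := by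
  rcases eq_or_ne c 0 with rfl | hc
  · simp [huaT]
  · refine (norm_sum_le _ _).trans ?_
    simp [huaE_norm c hc]

/-- stationary phase -/
lemma huaT_stat (M N : ℕ) (hM : M ≠ 0) (hN : N ≠ 0) (h1 : M * N ∣ 3 * M ^ 2) (h2 : M * N ∣ M ^ 3)
    (k l : ℤ) :
    huaT (M * N) k l = N * ∑ u ∈ Finset.range M,
      if (N : ℤ) ∣ 3 * k * (u : ℤ) ^ 2 + l then huaE (M * N) (k * (u : ℤ) ^ 3 + l * u) else 0 := by
  unfold huaT
  rw [hua_split, Finset.mul_sum]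
  refine Finset.sum_congr rfl fun u _ => ?_
  have h1' : ((M * N : ℕ) : ℤ) ∣ 3 * (M : ℤ) ^ 2 := by exact_mod_cast h1
  have h2' : ((M * N : ℕ) : ℤ) ∣ (M : ℤ) ^ 3 := by exact_mod_cast h2
  have key : ∀ v : ℕ, huaE (M * N) (k * ((u + M * v : ℕ) : ℤ) ^ 3 + l * ((u + M * v : ℕ) : ℤ))
      = huaE (M * N) (k * (u : ℤ) ^ 3 + l * u) * huaE N (v * (3 * k * (u : ℤ) ^ 2 + l)) := by
    intro v
    rw [← huaE_mul M N hM, ← huaE_add]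
    apply huaE_congr _ (mul_ne_zero hM hN)
    push_cast
    have : k * ((u : ℤ) + M * v) ^ 3 + l * (u + M * v)
        - (k * (u : ℤ) ^ 3 + l * u + M * (v * (3 * k * (u : ℤ) ^ 2 + l)))
        = (3 * (M : ℤ) ^ 2) * (k * u * v ^ 2) + (M : ℤ) ^ 3 * (k * v ^ 3) := by ring
    rw [this]
    push_cast at h1' h2'
    exact dvd_add (Dvd.dvd.mul_right h1' _) (Dvd.dvd.mul_right h2' _)
  rw [Finset.sum_congr rfl fun v _ => key v, ← Finset.mul_sum, huaE_geom N hN]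
  split_ifs <;> ring

lemma hua_sum_multiples (p n : ℕ) (hp : p ≠ 0) (F : ℕ → ℂ) :
    (∑ u ∈ Finset.range (p * n), if p ∣ u then F u else 0)
      = ∑ w ∈ Finset.range n, F (p * w) := by
  rw [hua_split, Finset.sum_eq_single 0]
  · simp
  · intro u hu hu0
    refine Finset.sum_eq_zero fun v _ => ?_
    rw [if_neg]
    intro h
    have h1 : p ∣ u := (Nat.dvd_add_left (Dvd.intro v rfl)).1 h
    exact hu0 (Nat.eq_zero_of_dvd_of_lt h1 (Finset.mem_range.1 hu))
  · intro h; simp at h; exact absurd h hp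

lemma hua_cond (p : ℕ) (hp : p.Prime) (k : ℤ) (hk : ¬ (p : ℤ) ∣ k) (u : ℕ) :
    (p : ℤ) ∣ k * (u : ℤ) ^ 2 ↔ p ∣ u := by
  have hp' : Prime (p : ℤ) := Nat.prime_iff_prime_int.1 hp
  constructor
  · intro h
    rcases hp'.dvd_or_dvd h with h | h
    · exact absurd h hk
    · exact Int.natCast_dvd_natCast.1 (hp'.dvd_of_dvd_pow h)
  · intro h
    exact Dvd.dvd.mul_left (dvd_pow (Int.natCast_dvd_natCast.2 h) two_ne_zero) _

/-- recursion for pure cubes -/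
lemma huaT_rec (p : ℕ) (hp : p.Prime) (a : ℕ) (k : ℤ) (hk : ¬ (p : ℤ) ∣ k) :
    huaT (p ^ (a + 3)) k 0 = p ^ 2 * huaT (p ^ a) k 0 := by
  have hp' : Prime (p : ℤ) := Nat.prime_iff_prime_int.1 hp
  have hp0 := hp.ne_zero
  have hE : ∀ w : ℕ, huaE (p ^ (a + 3)) (k * ((p * w : ℕ) : ℤ) ^ 3 + 0 * ((p * w : ℕ) : ℤ))
      = huaE (p ^ a) (k * (w : ℤ) ^ 3 + 0 * w) := by
    intro w
    rw [show p ^ (a + 3) = p ^ 3 * p ^ a by ring, ← huaE_mul (p ^ 3) (p ^ a) (pow_ne_zero _ hp0)]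
    congr 1
    push_cast; ring
  by_cases h3 : p = 3
  · have hc : p ^ (a + 3) = p ^ (a + 1) * p ^ 2 := by ring
    rw [hc, huaT_stat _ _ (pow_ne_zero _ hp0) (pow_ne_zero _ hp0), ← hc]
    · have hcond : ∀ u : ℕ, (((p ^ 2 : ℕ) : ℤ) ∣ 3 * k * (u : ℤ) ^ 2 + 0) ↔ p ∣ u := by
        intro u
        rw [← hua_cond p hp k hk, add_zero, h3]
        push_cast
        rw [show (9 : ℤ) = 3 * 3 by norm_num, mul_assoc]
        exact mul_dvd_mul_iff_left (by norm_num)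
      simp only [hcond]
      rw [pow_succ' p a, hua_sum_multiples p _ hp0, Finset.sum_congr rfl fun w _ => hE w]
      unfold huaT; push_cast; rfl
    · rw [h3]
      exact ⟨3 ^ a, by ring⟩
    · exact ⟨p ^ (2 * a), by ring⟩
  · have hc : p ^ (a + 3) = p ^ (a + 2) * p := by ring
    rw [hc, huaT_stat _ _ (pow_ne_zero _ hp0) hp0, ← hc]
    · have hk3 : ¬ (p : ℤ) ∣ 3 * k := by
        intro h
        rcases hp'.dvd_or_dvd h with h | h
        · have : p ∣ 3 := by exact_mod_cast h
          exact h3 ((Nat.prime_dvd_prime_iff_eq hp Nat.prime_three).1 this)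
        · exact hk h
      simp only [add_zero, hua_cond p hp _ hk3]
      rw [show p ^ (a + 2) = p * p ^ (a + 1) by ring, hua_sum_multiples p _ hp0,
        Finset.sum_congr rfl fun w _ => hE w, pow_succ p a, hua_split]
      have : ∀ u v : ℕ, huaE (p ^ a) (k * ((u + p ^ a * v : ℕ) : ℤ) ^ 3
          + 0 * ((u + p ^ a * v : ℕ) : ℤ)) = huaE (p ^ a) (k * (u : ℤ) ^ 3 + 0 * u) := by
        intro u v
        apply huaE_congr _ (pow_ne_zero _ hp0)
        push_cast
        exact ⟨k * (3 * u ^ 2 * v + 3 * u * p ^ a * v ^ 2 + (p ^ a) ^ 2 * v ^ 3), by ring⟩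
      simp only [this, Finset.sum_const, Finset.card_range, nsmul_eq_mul, ← Finset.mul_sum]
      unfold huaT; ring
    · exact ⟨3 * p ^ (a + 1), by ring⟩
    · exact ⟨p ^ (2 * a + 3), by ring⟩

/-- CRT -/
lemma huaT_mul (m n : ℕ) (hm : m ≠ 0) (hn : n ≠ 0) (h : Nat.Coprime m n) (k l : ℤ) :
    huaT (m * n) k l = huaT m (k * n ^ 2) l * huaT n (k * m ^ 2) l := by
  classical
  have hmn : m * n ≠ 0 := mul_ne_zero hm hn
  unfold huaT
  rw [Finset.sum_mul_sum, ← Finset.sum_product']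
  symm
  let φ : ℕ × ℕ → ℕ := fun x => (n * x.1 + m * x.2) % (m * n)
  have hinj : Set.InjOn φ (Finset.range m ×ˢ Finset.range n : Finset (ℕ × ℕ)) := by
    rintro ⟨x, y⟩ hx ⟨x', y'⟩ hx' heq
    simp only [Finset.coe_product, Set.mem_prod, Finset.mem_coe, Finset.mem_range] at hx hx'
    have heq' : n * x + m * y ≡ n * x' + m * y' [MOD m * n] := heq
    have e1 : n * x ≡ n * x' [MOD m] := by
      have := heq'.of_mul_right n
      simpa [Nat.ModEq, Nat.add_mod] using this
    have e2 : m * y ≡ m * y' [MOD n] := by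
      have := heq'.of_mul_left m
      simpa [Nat.ModEq, Nat.add_mod] using this
    have e3 := Nat.ModEq.eq_of_lt_of_lt (Nat.ModEq.cancel_left_of_coprime h e1) hx.1 hx'.1
    have e4 := Nat.ModEq.eq_of_lt_of_lt (Nat.ModEq.cancel_left_of_coprime h.symm e2) hx.2 hx'.2
    rw [e3, e4]
  have himg : (Finset.range m ×ˢ Finset.range n).image φ = Finset.range (m * n) := by
    apply Finset.eq_of_subset_of_card_le
    · intro z hz
      obtain ⟨x, _, rfl⟩ := Finset.mem_image.1 hz
      exact Finset.mem_range.2 (Nat.mod_lt _ (Nat.pos_of_ne_zero hmn))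
    · rw [Finset.card_image_of_injOn hinj]; simp
  rw [← himg, Finset.sum_image hinj]
  refine Finset.sum_congr rfl fun x _ => ?_
  rw [← huaE_mul n m hn, mul_comm n m, ← huaE_mul m n hm, ← huaE_add]
  apply huaE_congr _ hmn
  set X : ℤ := n * x.1 + m * x.2 with hX
  have hφ : ((m * n : ℕ) : ℤ) ∣ X - (φ x : ℤ) := by
    simp only [φ, hX]
    have := Int.emod_emod_of_dvd (n * x.1 + m * x.2 : ℤ) (dvd_refl ((m * n : ℕ) : ℤ))
    push_cast
    exact Int.dvd_self_sub_emod
  have h1 : ((m * n : ℕ) : ℤ) ∣ (k * X ^ 3 + l * X) - (k * (φ x : ℤ) ^ 3 + l * (φ x : ℤ)) := by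
    have : (k * X ^ 3 + l * X) - (k * (φ x : ℤ) ^ 3 + l * (φ x : ℤ))
      = (X - φ x) * (k * (X ^ 2 + X * φ x + (φ x : ℤ) ^ 2) + l) := by ring
    rw [this]; exact Dvd.dvd.mul_right hφ _
  have h2 : ((m * n : ℕ) : ℤ) ∣ (n * (k * n ^ 2 * (x.1 : ℤ) ^ 3 + l * x.1)
      + m * (k * m ^ 2 * (x.2 : ℤ) ^ 3 + l * x.2)) - (k * X ^ 3 + l * X) := by
    refine ⟨-(3 * k * x.1 * x.2 * X), ?_⟩
    rw [hX]; push_cast; ring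
  have := dvd_add h2 h1
  simpa using this

/-- quadratic Gauss sum bound -/
lemma hua_gauss (p : ℕ) (hp : p.Prime) (A t : ℤ) (hA : ¬ (p : ℤ) ∣ 2 * A) :
    ‖∑ w ∈ Finset.range p, huaE p (w * t + A * (w : ℤ) ^ 2)‖ ≤ Real.sqrt p := by
  classical
  have : Fact p.Prime := ⟨hp⟩
  have : NeZero p := ⟨hp.ne_zero⟩
  set ψ : AddChar (ZMod p) ℂ := ZMod.stdAddChar with hψ
  set α : ZMod p := (A : ZMod p)
  set β : ZMod p := (t : ZMod p)
  have h1 : ∑ w ∈ Finset.range p, huaE p (w * t + A * (w : ℤ) ^ 2)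
      = ∑ x : ZMod p, ψ (β * x + α * x ^ 2) := by
    rw [← hua_sum_zmod]
    refine Finset.sum_congr rfl fun w _ => ?_
    rw [huaE_eq]; push_cast; rw [mul_comm]
  have hα : 2 * α ≠ 0 := by
    intro h
    apply hA
    rw [← ZMod.intCast_zmod_eq_zero_iff_dvd]; push_cast; exact h
  rw [h1]
  set Z := ∑ x : ZMod p, ψ (β * x + α * x ^ 2) with hZ
  have hconj : ∀ x, (starRingEnd ℂ) (ψ x) = ψ (-x) := fun x => (AddChar.map_neg_eq_conj ψ x).symm
  have h2 : Z * (starRingEnd ℂ) Z = p := by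
    rw [hZ, map_sum, Finset.sum_mul_sum]
    have : ∀ x y : ZMod p, ψ (β * x + α * x ^ 2) * (starRingEnd ℂ) (ψ (β * y + α * y ^ 2))
        = ψ (β * (x - y) + α * (x ^ 2 - y ^ 2)) := by
      intro x y
      rw [hconj, ← AddChar.map_add_eq_mul]; congr 1; ring
    simp only [this]
    rw [Finset.sum_comm]
    have e : ∀ y : ZMod p, ∑ x : ZMod p, ψ (β * (x - y) + α * (x ^ 2 - y ^ 2))
        = ∑ h : ZMod p, ψ (β * h + α * h ^ 2) * ψ (y * (2 * α * h)) := by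
      intro y
      rw [← Equiv.sum_comp (Equiv.addRight y)]
      refine Finset.sum_congr rfl fun h _ => ?_
      rw [← AddChar.map_add_eq_mul]; congr 1
      simp only [Equiv.coe_addRight]; ring
    simp only [e]
    rw [Finset.sum_comm]
    have e2 : ∀ h : ZMod p, ∑ y : ZMod p, ψ (β * h + α * h ^ 2) * ψ (y * (2 * α * h))
        = if h = 0 then (p : ℂ) else 0 := by
      intro h
      rw [← Finset.mul_sum, AddChar.sum_mulShift _ (ZMod.isPrimitive_stdAddChar p)]
      by_cases hh : h = 0
      · subst hh; simp
      · rw [if_neg (mul_ne_zero hα hh), if_neg hh]; simp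
    simp only [e2]
    simp
  rw [Complex.mul_conj, Complex.normSq_eq_norm_sq] at h2
  have h3 : ‖Z‖ ^ 2 = p := by exact_mod_cast h2
  rw [← h3, Real.sqrt_sq (norm_nonneg _)]

lemma hua_pow_dvd {p : ℤ} (hp : Prime p) (n : ℕ) : ∀ (m : ℕ) (X Y : ℤ), p ^ (m + n) ∣ X * Y →
    p ^ (m + 1) ∣ X ∨ p ^ n ∣ Y := by
  intro m
  induction m with
  | zero =>
    intro X Y h
    by_cases hX : p ∣ X
    · left; simpa using hX
    · right; rw [zero_add] at h; exact hp.pow_dvd_of_dvd_mul_left n hX h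
  | succ m ih =>
    intro X Y h
    by_cases hX : p ∣ X
    · obtain ⟨X', rfl⟩ := hX
      have h' : p ^ (m + n) ∣ X' * Y := by
        have : p * p ^ (m + n) ∣ p * (X' * Y) := by
          convert h using 1 <;> ring
        exact (mul_dvd_mul_iff_left hp.ne_zero).1 this
      rcases ih X' Y h' with h | h
      · left; rw [pow_succ' p (m + 1)]; exact mul_dvd_mul_left p h
      · right; exact h
    · right
      exact (pow_dvd_pow p (by omega)).trans (hp.pow_dvd_of_dvd_mul_left _ hX h)

lemma hua_count_class (p b h : ℕ) (hh : h ≤ b) (x : ℤ) :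
    ((Finset.range (p ^ b)).filter fun u : ℕ => ((p : ℤ) ^ h ∣ (u : ℤ) - x)).card ≤ p ^ (b - h) := by
  rw [Finset.card_filter]
  have hb : p ^ b = p ^ h * p ^ (b - h) := by rw [← pow_add]; congr 1; omega
  rw [hb, hua_split]
  have h1 : ∀ u v : ℕ, ((p : ℤ) ^ h ∣ ((u + p ^ h * v : ℕ) : ℤ) - x) ↔ ((p : ℤ) ^ h ∣ (u : ℤ) - x) := by
    intro u v
    push_cast
    rw [show (u : ℤ) + p ^ h * v - x = p ^ h * v + (u - x) by ring]
    exact dvd_add_right (Dvd.intro _ rfl)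
  simp only [h1, Finset.sum_const, Finset.card_range, smul_eq_mul, ← Finset.mul_sum]
  rw [← Finset.card_filter]
  have : ((Finset.range (p ^ h)).filter fun u : ℕ => ((p : ℤ) ^ h ∣ (u : ℤ) - x)).card ≤ 1 := by
    rw [Finset.card_le_one]
    intro a ha c hc
    simp only [Finset.mem_filter, Finset.mem_range] at ha hc
    have h2 := dvd_sub ha.2 hc.2
    rw [show (a : ℤ) - x - (c - x) = a - c by ring] at h2
    have ha1 : (a : ℤ) < (p : ℤ) ^ h := by exact_mod_cast ha.1
    have hc1 : (c : ℤ) < (p : ℤ) ^ h := by exact_mod_cast hc.1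
    have h3 := Int.eq_zero_of_abs_lt_dvd h2 (by rw [abs_lt]; constructor <;> linarith [Int.natCast_nonneg a, Int.natCast_nonneg c])
    omega
  calc p ^ (b - h) * _ ≤ p ^ (b - h) * 1 := Nat.mul_le_mul_left _ this
    _ = _ := mul_one _

/-- Number of critical points modulo `N`. -/
def huaRho (N : ℕ) (k l : ℤ) : ℕ :=
  ((Finset.range N).filter fun u : ℕ => ((N : ℤ) ∣ 3 * k * (u : ℤ) ^ 2 + l)).card

lemma huaRho_le (p : ℕ) (hp : p.Prime) (b e : ℕ) (he : (5 ≤ p ∧ e = 0) ∨ (p < 5 ∧ e = 1))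
    (k l : ℤ) (hk : ¬ (p : ℤ) ∣ k) :
    ∃ w : ℕ, 2 * w ≤ b ∧ (p : ℤ) ^ (2 * w) ∣ l ∧ huaRho (p ^ b) k l ≤ 2 * p ^ (w + 2 * e) := by
  have hp' : Prime (p : ℤ) := Nat.prime_iff_prime_int.1 hp
  have h2e : p < 5 → p = 2 ∨ p = 3 := by
    intro h
    have := hp.two_le
    interval_cases p
    · left; rfl
    · right; rfl
    · exact absurd hp (by norm_num)
  have hnd : ∀ q : ℕ, q.Prime → q ≠ p → ¬ (p : ℤ) ∣ (q : ℤ) := by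
    intro q hq hqp h
    have : p ∣ q := by exact_mod_cast h
    exact hqp ((Nat.prime_dvd_prime_iff_eq hp hq).1 this).symm
  have F1 : ∀ Z : ℤ, (p : ℤ) ^ b ∣ 3 * Z → (p : ℤ) ^ (b - e) ∣ Z := by
    intro Z hZ
    by_cases h3 : p = 3
    · have he1 : e = 1 := by omega
      rw [he1]
      rcases Nat.eq_zero_or_pos b with rfl | hb
      · simp
      · obtain ⟨b', rfl⟩ : ∃ b', b = b' + 1 := ⟨b - 1, by omega⟩
        rw [pow_succ', show (3 : ℤ) = (p : ℤ) by rw [h3]; rfl] at hZ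
        simpa using (mul_dvd_mul_iff_left hp'.ne_zero).1 hZ
    · have := hp'.pow_dvd_of_dvd_mul_left b (hnd 3 Nat.prime_three (Ne.symm h3)) (by exact_mod_cast hZ)
      exact (pow_dvd_pow _ (by omega)).trans this
  have F2 : ∀ (w : ℕ) (z : ℤ), (p : ℤ) ^ (w + e + 1) ∣ 2 * z → (p : ℤ) ^ (w + 1) ∣ z := by
    intro w z hz
    by_cases h2 : p = 2
    · have he1 : e = 1 := by omega
      rw [he1, pow_succ', show (2 : ℤ) = (p : ℤ) by rw [h2]; rfl] at hz
      exact (mul_dvd_mul_iff_left hp'.ne_zero).1 hz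
    · have := hp'.pow_dvd_of_dvd_mul_left _ (hnd 2 Nat.prime_two (Ne.symm h2)) (by exact_mod_cast hz)
      exact (pow_dvd_pow _ (by omega)).trans this
  rcases ((Finset.range (p ^ b)).filter fun u : ℕ =>
    (((p ^ b : ℕ) : ℤ) ∣ 3 * k * (u : ℤ) ^ 2 + l)).eq_empty_or_nonempty with hemp | ⟨u0, hu0⟩
  · refine ⟨0, by omega, by simp, ?_⟩
    unfold huaRho; rw [hemp]; simp
  · have hu0' : (p : ℤ) ^ b ∣ 3 * k * (u0 : ℤ) ^ 2 + l := by
      have := (Finset.mem_filter.1 hu0).2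
      push_cast at this; exact this
    classical
    set w := Nat.findGreatest (fun w => (p : ℤ) ^ w ∣ (u0 : ℤ)) (b / 2) with hw
    have hw1 : w ≤ b / 2 := Nat.findGreatest_le _
    have hw2 : (p : ℤ) ^ w ∣ (u0 : ℤ) :=
      Nat.findGreatest_spec (P := fun w => (p : ℤ) ^ w ∣ (u0 : ℤ)) (Nat.zero_le _) (by simp)
    have hw3 : w < b / 2 → ¬ (p : ℤ) ^ (w + 1) ∣ (u0 : ℤ) := by
      intro h
      exact Nat.findGreatest_is_greatest (P := fun w => (p : ℤ) ^ w ∣ (u0 : ℤ))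
        (Nat.lt_succ_self _) h
    refine ⟨w, by omega, ?_, ?_⟩
    · have h1 : (p : ℤ) ^ (2 * w) ∣ 3 * k * (u0 : ℤ) ^ 2 := by
        apply Dvd.dvd.mul_left
        rw [mul_comm 2 w, pow_mul]; exact pow_dvd_pow_of_dvd hw2 2
      have h2 : (p : ℤ) ^ (2 * w) ∣ 3 * k * (u0 : ℤ) ^ 2 + l :=
        (pow_dvd_pow _ (by omega)).trans hu0'
      exact (dvd_add_right h1).1 h2
    · set h := b - (w + 2 * e) with hh
      have claim : ∀ u : ℤ, (p : ℤ) ^ b ∣ 3 * k * u ^ 2 + l →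
          (p : ℤ) ^ h ∣ u - u0 ∨ (p : ℤ) ^ h ∣ u - (-u0) := by
        intro u hu
        rcases Nat.eq_zero_or_pos h with h0 | h0
        · left; rw [h0]; simp
        have h1 : (p : ℤ) ^ b ∣ 3 * ((u - u0) * (u + u0)) * k := by
          have := dvd_sub hu hu0'
          rwa [show 3 * k * u ^ 2 + l - (3 * k * (u0 : ℤ) ^ 2 + l)
            = 3 * ((u - u0) * (u + u0)) * k by ring] at this
        have h2 := F1 _ (hp'.pow_dvd_of_dvd_mul_right _ hk h1)
        rw [sub_neg_eq_add]
        by_cases hwb : w < b / 2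
        · have hn := hw3 hwb
          by_contra! hcon
          have d1 := (hua_pow_dvd hp' h (w + e) (u - u0) (u + u0)
            ((pow_dvd_pow _ (by omega)).trans h2)).resolve_right hcon.2
          have h2' : (p : ℤ) ^ (b - e) ∣ (u + u0) * (u - u0) := by rwa [mul_comm]
          have d2 := (hua_pow_dvd hp' h (w + e) (u + u0) (u - u0)
            ((pow_dvd_pow _ (by omega)).trans h2')).resolve_right hcon.1
          have d3 := dvd_sub d2 d1
          rw [show u + u0 - (u - u0) = 2 * (u0 : ℤ) by ring] at d3
          exact hn (F2 w _ d3)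
        · have d1 := hua_pow_dvd hp' h (h - 1) (u - u0) (u + u0)
            ((pow_dvd_pow _ (by omega)).trans h2)
          rwa [Nat.sub_add_cancel h0] at d1
      unfold huaRho
      have hsub : ((Finset.range (p ^ b)).filter fun u : ℕ =>
          (((p ^ b : ℕ) : ℤ) ∣ 3 * k * (u : ℤ) ^ 2 + l)) ⊆
          ((Finset.range (p ^ b)).filter fun u : ℕ => ((p : ℤ) ^ h ∣ (u : ℤ) - u0)) ∪
          ((Finset.range (p ^ b)).filter fun u : ℕ => ((p : ℤ) ^ h ∣ (u : ℤ) - (-u0))) := by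
        intro u hu
        rw [Finset.mem_filter] at hu
        rw [Finset.mem_union, Finset.mem_filter, Finset.mem_filter]
        have := claim u (by have := hu.2; push_cast at this; exact this)
        tauto
      refine (Finset.card_le_card hsub).trans ((Finset.card_union_le _ _).trans ?_)
      have c1 := hua_count_class p b h (by omega) (u0 : ℤ)
      have c2 := hua_count_class p b h (by omega) (-u0 : ℤ)
      have c3 : p ^ (b - h) ≤ p ^ (w + 2 * e) := Nat.pow_le_pow_right hp.pos (by omega)
      omega


lemma huaT_prime (p : ℕ) (hp : p.Prime) (hp5 : 5 ≤ p) (k l : ℤ) (hk : ¬ (p : ℤ) ∣ k) :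
    ‖huaT p k l‖ ≤ 2 * Real.sqrt p := by
  have : Fact p.Prime := ⟨hp⟩
  have : NeZero p := ⟨hp.ne_zero⟩
  have h := hua_weil p hp5 (k : ZMod p) (l : ZMod p)
    (by rwa [ne_eq, ZMod.intCast_zmod_eq_zero_iff_dvd])
  convert h using 2
  unfold huaT
  rw [← hua_sum_zmod]
  refine Finset.sum_congr rfl fun d _ => ?_
  rw [huaE_eq]; push_cast; rfl

lemma huaT_even (p : ℕ) (hp : p.Prime) (b : ℕ) (k l : ℤ) :
    ‖huaT (p ^ (2 * b)) k l‖ ≤ p ^ b * huaRho (p ^ b) k l := by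
  have hp0 := pow_ne_zero b hp.ne_zero
  rw [show p ^ (2 * b) = p ^ b * p ^ b by ring,
    huaT_stat _ _ hp0 hp0 ⟨3, by ring⟩ ⟨p ^ b, by ring⟩, norm_mul, Complex.norm_natCast]
  push_cast
  refine mul_le_mul_of_nonneg_left ?_ (by positivity)
  rw [← Finset.sum_filter]
  refine (norm_sum_le _ _).trans ?_
  unfold huaRho
  rw [Finset.sum_congr rfl (g := fun _ => (1 : ℝ))]
  · simp
  · intro x _
    exact huaE_norm _ (mul_ne_zero hp0 hp0) _

lemma huaT_odd (p : ℕ) (hp : p.Prime) (b : ℕ) (hb : 1 ≤ b) (k l : ℤ) (G : ℝ)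
    (hG : ∀ u : ℕ, ((p ^ b : ℕ) : ℤ) ∣ 3 * k * (u : ℤ) ^ 2 + l → ∀ t : ℤ,
      ‖∑ w ∈ Finset.range p, huaE p (w * t + 3 * k * u * (w : ℤ) ^ 2)‖ ≤ G) :
    ‖huaT (p ^ (2 * b + 1)) k l‖ ≤ p ^ b * (huaRho (p ^ b) k l * G) := by
  have hp0 := hp.ne_zero
  have hc : p ^ (2 * b + 1) = p ^ (b + 1) * p ^ b := by ring
  rw [hc, huaT_stat _ _ (pow_ne_zero _ hp0) (pow_ne_zero _ hp0) ⟨3 * p, by ring⟩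
    ⟨p ^ (b + 2), by ring⟩, ← hc, norm_mul, Complex.norm_natCast]
  push_cast
  refine mul_le_mul_of_nonneg_left ?_ (by positivity)
  rw [pow_succ, hua_split]
  have hcond : ∀ u w : ℕ, ((p : ℤ) ^ b ∣ 3 * k * ((u + p ^ b * w : ℕ) : ℤ) ^ 2 + l) ↔
      ((p ^ b : ℕ) : ℤ) ∣ 3 * k * (u : ℤ) ^ 2 + l := by
    intro u w
    push_cast
    rw [show 3 * k * ((u : ℤ) + p ^ b * w) ^ 2 + l
      = p ^ b * (3 * k * (2 * u * w + p ^ b * w ^ 2)) + (3 * k * (u : ℤ) ^ 2 + l) by ring]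
    exact dvd_add_right (Dvd.intro _ rfl)
  have hterm : ∀ u : ℕ, ‖∑ w ∈ Finset.range p,
      (if (p : ℤ) ^ b ∣ 3 * k * ((u + p ^ b * w : ℕ) : ℤ) ^ 2 + l then
        huaE (p ^ (2 * b + 1)) (k * ((u + p ^ b * w : ℕ) : ℤ) ^ 3 + l * ((u + p ^ b * w : ℕ) : ℤ))
        else 0)‖ ≤ if ((p ^ b : ℕ) : ℤ) ∣ 3 * k * (u : ℤ) ^ 2 + l then G else 0 := by
    intro u
    simp only [hcond]
    split_ifs with hu
    · obtain ⟨t, ht⟩ := hu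
      have e : ∀ w : ℕ, huaE (p ^ (2 * b + 1)) (k * ((u + p ^ b * w : ℕ) : ℤ) ^ 3
          + l * ((u + p ^ b * w : ℕ) : ℤ)) = huaE (p ^ (2 * b + 1)) (k * (u : ℤ) ^ 3 + l * u) *
            huaE p (w * t + 3 * k * u * (w : ℤ) ^ 2) := by
        intro w
        rw [← huaE_mul (p ^ (2 * b)) p (pow_ne_zero _ hp0), ← pow_succ, ← huaE_add]
        apply huaE_congr _ (pow_ne_zero _ hp0)
        obtain ⟨b', rfl⟩ : ∃ b', b = b' + 1 := ⟨b - 1, by omega⟩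
        refine ⟨p ^ b' * k * w ^ 3, ?_⟩
        push_cast at ht ⊢
        linear_combination ((p : ℤ) ^ (b' + 1) * w) * ht
      simp only [e]
      rw [← Finset.mul_sum, norm_mul, huaE_norm _ (pow_ne_zero _ hp0), one_mul]
      exact hG u ⟨t, ht⟩ t
    · simp
  refine (norm_sum_le _ _).trans ((Finset.sum_le_sum fun u _ => hterm u).trans ?_)
  rw [← Finset.sum_filter]
  unfold huaRho
  simp

lemma huaT_primePow (p : ℕ) (hp : p.Prime) (a : ℕ) (ha : 0 < a) (k l : ℤ) (hk : ¬ (p : ℤ) ∣ k) :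
    ‖huaT (p ^ a) k l‖ ≤ 54 * Real.sqrt (p ^ a : ℝ) * (Int.gcd l (p ^ a : ℕ) : ℝ) := by
  have hp' : Prime (p : ℤ) := Nat.prime_iff_prime_int.1 hp
  have hp1 : (1 : ℝ) ≤ p := by exact_mod_cast hp.one_lt.le
  have hsq : Real.sqrt p * Real.sqrt p = p := Real.mul_self_sqrt (by linarith)
  have hs1 : 1 ≤ Real.sqrt p := Real.one_le_sqrt.2 hp1
  have hsp : Real.sqrt p ≤ p := by nlinarith
  have hgpos : 0 < Int.gcd l (p ^ a : ℕ) :=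
    Int.gcd_pos_of_ne_zero_right _ (by exact_mod_cast pow_ne_zero a hp.ne_zero)
  have hg1 : (1 : ℝ) ≤ (Int.gcd l (p ^ a : ℕ) : ℝ) := by exact_mod_cast hgpos
  set g : ℝ := (Int.gcd l (p ^ a : ℕ) : ℝ) with hg
  have hdiv : ∀ n : ℕ, n ≤ a → (p : ℤ) ^ n ∣ l → (p : ℝ) ^ n ≤ g := by
    intro n hn hl
    have : p ^ n ∣ Int.gcd l (p ^ a : ℕ) := by
      apply Int.dvd_gcd
      · push_cast; exact hl
      · push_cast; exact pow_dvd_pow _ hn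
    have := Nat.le_of_dvd hgpos this
    rw [hg]; exact_mod_cast this
  obtain ⟨e, he⟩ : ∃ e : ℕ, (5 ≤ p ∧ e = 0) ∨ (p < 5 ∧ e = 1) := by
    rcases le_or_gt 5 p with h | h
    · exact ⟨0, Or.inl ⟨h, rfl⟩⟩
    · exact ⟨1, Or.inr ⟨h, rfl⟩⟩
  have hp3 : p < 5 → p ≤ 3 := by
    intro h
    by_contra hh
    have : p = 4 := by omega
    rw [this] at hp; exact absurd hp (by norm_num)
  have he9 : (p : ℝ) ^ (2 * e) ≤ 9 := by
    rcases he with ⟨_, rfl⟩ | ⟨h, rfl⟩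
    · norm_num
    · have : (p : ℝ) ≤ 3 := by exact_mod_cast hp3 h
      calc (p : ℝ) ^ (2 * 1) ≤ 3 ^ (2 * 1) := by gcongr
        _ = 9 := by norm_num
  rcases Nat.even_or_odd' a with ⟨b, rfl | rfl⟩
  · obtain ⟨w, hw, hwl, hrho⟩ := huaRho_le p hp b e he k l hk
    have hrho' : (huaRho (p ^ b) k l : ℝ) ≤ 2 * (p ^ w * p ^ (2 * e)) := by
      rw [← pow_add]; exact_mod_cast hrho
    have h1 := huaT_even p hp b k l
    have h2 : Real.sqrt ((p : ℝ) ^ (2 * b)) = p ^ b := by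
      rw [mul_comm, pow_mul, Real.sqrt_sq (by positivity)]
    rw [h2]
    have h3 : (p : ℝ) ^ w ≤ g :=
      (pow_le_pow_right₀ hp1 (by omega)).trans (hdiv (2 * w) (by omega) hwl)
    have hpb : (0 : ℝ) < p ^ b := by positivity
    calc ‖huaT (p ^ (2 * b)) k l‖ ≤ p ^ b * huaRho (p ^ b) k l := h1
      _ ≤ p ^ b * (2 * (g * 9)) := by gcongr; exact hrho'.trans (by gcongr)
      _ ≤ 54 * p ^ b * g := by nlinarith [mul_pos hpb (lt_of_lt_of_le one_pos hg1)]
  · rcases Nat.eq_zero_or_pos b with rfl | hb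
    · simp only [mul_zero, zero_add, pow_one]
      rcases le_or_gt 5 p with h | h
      · refine (huaT_prime p hp h k l hk).trans ?_
        nlinarith
      · refine (huaT_trivial p k l).trans ?_
        have : (p : ℝ) ≤ 3 := by exact_mod_cast hp3 h
        nlinarith
    · obtain ⟨w, hw, hwl, hrho⟩ := huaRho_le p hp b e he k l hk
      have hrho' : (huaRho (p ^ b) k l : ℝ) ≤ 2 * (p ^ w * p ^ (2 * e)) := by
        rw [← pow_add]; exact_mod_cast hrho
      have h2 : Real.sqrt ((p : ℝ) ^ (2 * b + 1)) = p ^ b * Real.sqrt p := by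
        rw [pow_succ, Real.sqrt_mul (by positivity), mul_comm 2 b, pow_mul,
          Real.sqrt_sq (by positivity)]
      rw [h2]
      have h3' := hdiv (2 * w) (by omega) hwl
      have h3 : (p : ℝ) ^ w ≤ g := (pow_le_pow_right₀ hp1 (by omega)).trans h3'
      have hpb : (0 : ℝ) < p ^ b := by positivity
      have hGp : ∀ u : ℕ, ((p ^ b : ℕ) : ℤ) ∣ 3 * k * (u : ℤ) ^ 2 + l → ∀ t : ℤ,
          ‖∑ w ∈ Finset.range p, huaE p (w * t + 3 * k * u * (w : ℤ) ^ 2)‖ ≤ p := by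
        intro u _ t
        refine (norm_sum_le _ _).trans ?_
        simp [huaE_norm p hp.ne_zero]
      have hpg : (0 : ℝ) < p ^ b * g := mul_pos hpb (lt_of_lt_of_le one_pos hg1)
      rcases he with ⟨h5, rfl⟩ | ⟨h5, rfl⟩
      · simp only [mul_zero, pow_zero, mul_one] at hrho'
        by_cases hl : (p : ℤ) ∣ l
        · have h1 := huaT_odd p hp b hb k l p hGp
          have h4 : (p : ℝ) ^ w * Real.sqrt p ≤ g := by
            rcases Nat.eq_zero_or_pos w with rfl | hw0
            · have := hdiv 1 (by omega) (by simpa using hl)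
              simp only [pow_zero, one_mul, pow_one] at this ⊢
              linarith
            · calc (p : ℝ) ^ w * Real.sqrt p ≤ p ^ w * p := by gcongr
                _ = p ^ (w + 1) := by ring
                _ ≤ p ^ (2 * w) := pow_le_pow_right₀ hp1 (by omega)
                _ ≤ g := h3'
          calc _ ≤ (p : ℝ) ^ b * (huaRho (p ^ b) k l * p) := h1
            _ ≤ p ^ b * (2 * p ^ w * p) := by gcongr
            _ = 2 * p ^ b * Real.sqrt p * (p ^ w * Real.sqrt p) := by
                nth_rewrite 3 [← hsq]; ring
            _ ≤ 2 * p ^ b * Real.sqrt p * g := by gcongr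
            _ ≤ 54 * (p ^ b * Real.sqrt p) * g := by nlinarith [mul_pos hpg (lt_of_lt_of_le one_pos hs1)]
        · have hG : ∀ u : ℕ, ((p ^ b : ℕ) : ℤ) ∣ 3 * k * (u : ℤ) ^ 2 + l → ∀ t : ℤ,
              ‖∑ w ∈ Finset.range p, huaE p (w * t + 3 * k * u * (w : ℤ) ^ 2)‖ ≤ Real.sqrt p := by
            intro u hu t
            apply hua_gauss p hp
            intro hd
            have hdu : (p : ℤ) ∣ 3 * k * (u : ℤ) ^ 2 + l := by
              refine dvd_trans ?_ hu
              push_cast; exact dvd_pow_self _ (by omega)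
            have hnu : ¬ (p : ℤ) ∣ u := by
              intro hpu
              exact hl ((dvd_add_right (Dvd.dvd.mul_left (dvd_pow hpu two_ne_zero) _)).1 hdu)
            have hsmall : ∀ q : ℕ, 0 < q → q < 5 → ¬ (p : ℤ) ∣ (q : ℤ) := by
              intro q hq hq5 h
              have : p ∣ q := by exact_mod_cast h
              have := Nat.le_of_dvd hq this
              omega
            rcases hp'.dvd_or_dvd hd with h | h
            · exact hsmall 2 (by norm_num) (by norm_num) (by exact_mod_cast h)
            · rcases hp'.dvd_or_dvd h with h | h
              · rcases hp'.dvd_or_dvd h with h | h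
                · exact hsmall 3 (by norm_num) (by norm_num) (by exact_mod_cast h)
                · exact hk h
              · exact hnu h
          have h1 := huaT_odd p hp b hb k l _ hG
          calc _ ≤ (p : ℝ) ^ b * (huaRho (p ^ b) k l * Real.sqrt p) := h1
            _ ≤ p ^ b * (2 * g * Real.sqrt p) := by gcongr; exact hrho'.trans (by gcongr)
            _ ≤ 54 * (p ^ b * Real.sqrt p) * g := by nlinarith [mul_pos hpg (lt_of_lt_of_le one_pos hs1)]
      · have h1 := huaT_odd p hp b hb k l p hGp
        have hp3' : (p : ℝ) ≤ 3 := by exact_mod_cast hp3 h5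
        calc _ ≤ (p : ℝ) ^ b * (huaRho (p ^ b) k l * p) := h1
          _ ≤ p ^ b * (2 * (g * 9) * 3) := by gcongr; exact hrho'.trans (by gcongr)
          _ = 54 * (p ^ b * 1) * g := by ring
          _ ≤ 54 * (p ^ b * Real.sqrt p) * g := by gcongr

lemma huaT_cube (p : ℕ) (hp : p.Prime) (B : ℝ) (k : ℤ) (hk : ¬ (p : ℤ) ∣ k)
    (h : ∀ a < 3, ‖huaT (p ^ a) k 0‖ ≤ B * ((p ^ a : ℕ) : ℝ) ^ ((2 : ℝ) / 3)) (a : ℕ) :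
    ‖huaT (p ^ a) k 0‖ ≤ B * ((p ^ a : ℕ) : ℝ) ^ ((2 : ℝ) / 3) := by
  induction a using Nat.strong_induction_on with
  | _ a ih =>
    by_cases ha : a < 3
    · exact h a ha
    · obtain ⟨a', rfl⟩ : ∃ a', a = a' + 3 := ⟨a - 3, by omega⟩
      have h1 := ih a' (by omega)
      rw [huaT_rec p hp a' k hk, norm_mul, norm_pow, Complex.norm_natCast]
      have h2 : ((p ^ (a' + 3) : ℕ) : ℝ) ^ ((2 : ℝ) / 3)
          = p ^ 2 * ((p ^ a' : ℕ) : ℝ) ^ ((2 : ℝ) / 3) := by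
        rw [pow_add, Nat.cast_mul, Real.mul_rpow (by positivity) (by positivity), mul_comm]
        congr 1
        rw [Nat.cast_pow, ← Real.rpow_natCast, ← Real.rpow_natCast, ← Real.rpow_mul (by positivity)]
        norm_num
      rw [h2]
      calc (p : ℝ) ^ 2 * ‖huaT (p ^ a') k 0‖ ≤ p ^ 2 * (B * ((p ^ a' : ℕ) : ℝ) ^ ((2 : ℝ) / 3)) := by
            gcongr
        _ = _ := by ring

lemma huaT_cube_large (p : ℕ) (hp : p.Prime) (hp64 : 64 ≤ p) (k : ℤ) (hk : ¬ (p : ℤ) ∣ k) (a : ℕ) :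
    ‖huaT (p ^ a) k 0‖ ≤ 1 * ((p ^ a : ℕ) : ℝ) ^ ((2 : ℝ) / 3) := by
  apply huaT_cube p hp 1 k hk
  have hp0 : (0 : ℝ) < p := by exact_mod_cast hp.pos
  have h6 : (2 : ℝ) ≤ (p : ℝ) ^ ((1 : ℝ) / 6) := by
    have : ((64 : ℝ)) ^ ((1 : ℝ) / 6) ≤ (p : ℝ) ^ ((1 : ℝ) / 6) :=
      Real.rpow_le_rpow (by norm_num) (by exact_mod_cast hp64) (by norm_num)
    refine le_trans (le_of_eq ?_) this
    rw [show (64 : ℝ) = 2 ^ (6 : ℝ) by norm_num, ← Real.rpow_mul (by norm_num)]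
    norm_num
  intro a ha
  rw [one_mul]
  interval_cases a
  · refine (huaT_trivial _ _ _).trans ?_
    simp
  · rw [pow_one]
    refine (huaT_prime p hp (by omega) k 0 hk).trans ?_
    rw [show (2 : ℝ) / 3 = 1 / 6 + 1 / 2 by norm_num, Real.rpow_add hp0, Real.sqrt_eq_rpow]
    gcongr
  · have h1 := huaT_even p hp 1 k 0
    obtain ⟨w, hw, -, hrho⟩ := huaRho_le p hp 1 0 (Or.inl ⟨by omega, rfl⟩) k 0 hk
    have hw0 : w = 0 := by omega
    subst hw0
    simp only [mul_one, pow_one, mul_zero, add_zero, pow_zero] at h1 hrho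
    have hrho' : (huaRho p k 0 : ℝ) ≤ 2 := by exact_mod_cast hrho
    have h2 : ((p ^ 2 : ℕ) : ℝ) ^ ((2 : ℝ) / 3)
        = (p : ℝ) * ((p : ℝ) ^ ((1 : ℝ) / 6) * (p : ℝ) ^ ((1 : ℝ) / 6)) := by
      rw [Nat.cast_pow, ← Real.rpow_natCast, ← Real.rpow_mul hp0.le, ← Real.rpow_add hp0]
      nth_rewrite 2 [← Real.rpow_one (p : ℝ)]
      rw [← Real.rpow_add hp0]
      norm_num
    rw [h2]
    refine h1.trans ?_
    gcongr
    nlinarith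

lemma huaT_cube_small (p : ℕ) (hp : p.Prime) (hp64 : p < 64) (k : ℤ) (hk : ¬ (p : ℤ) ∣ k) (a : ℕ) :
    ‖huaT (p ^ a) k 0‖ ≤ 4096 * ((p ^ a : ℕ) : ℝ) ^ ((2 : ℝ) / 3) := by
  apply huaT_cube p hp _ k hk
  intro a ha
  refine (huaT_trivial _ _ _).trans ?_
  have h1 : (1 : ℝ) ≤ ((p ^ a : ℕ) : ℝ) ^ ((2 : ℝ) / 3) :=
    Real.one_le_rpow (by exact_mod_cast Nat.one_le_pow _ _ hp.pos) (by norm_num)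
  have h2 : p ^ a ≤ 4096 := by
    calc p ^ a ≤ 64 ^ a := Nat.pow_le_pow_left hp64.le a
      _ ≤ 64 ^ 2 := Nat.pow_le_pow_right (by norm_num) (by omega)
      _ = 4096 := by norm_num
  have h3 : ((p ^ a : ℕ) : ℝ) ≤ 4096 := by exact_mod_cast h2
  linarith

lemma hua_global (P0 : ℕ) (K : ℝ) (hK : 1 ≤ K) (w : ℕ → ℝ) (w1 : w 1 = 1) (wnn : ∀ n, 0 ≤ w n)
    (wmul : ∀ m n, Nat.Coprime m n → w (m * n) = w m * w n) (l : ℤ)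
    (hpp : ∀ (p a : ℕ) (k : ℤ), p.Prime → 0 < a → ¬ (p : ℤ) ∣ k →
      ‖huaT (p ^ a) k l‖ ≤ (if p < P0 then K else 1) * w (p ^ a)) (c : ℕ) :
    0 < c → ∀ k : ℤ, Int.gcd k c = 1 → ‖huaT c k l‖ ≤ K ^ P0 * w c := by
  have main : 0 < c → ∀ k : ℤ, Int.gcd k c = 1 →
      ‖huaT c k l‖ ≤ K ^ (c.primeFactors.filter (· < P0)).card * w c := by
    induction c using Nat.recOnPosPrimePosCoprime with
    | zero => intro h; exact absurd h (lt_irrefl _)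
    | one =>
      intro _ k _
      refine (huaT_trivial _ _ _).trans ?_
      simp [w1]
    | prime_pow p n hp hn =>
      intro _ k hk
      have hk' : ¬ (p : ℤ) ∣ k := by
        intro h
        have h1 : p ∣ Int.gcd k (p ^ n : ℕ) := by
          apply Int.dvd_gcd h
          push_cast; exact dvd_pow_self _ hn.ne'
        rw [hk] at h1
        exact hp.one_lt.ne' (Nat.dvd_one.1 h1)
      refine (hpp p n k hp hn hk').trans (le_of_eq ?_)
      congr 1
      rw [Nat.primeFactors_prime_pow hn.ne' hp, Finset.filter_singleton]
      split_ifs <;> simp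
    | coprime a b ha hb hab iha ihb =>
      intro _ k hk
      have hk0 : Nat.Coprime k.natAbs (a * b) := by
        have : Int.gcd k ((a * b : ℕ) : ℤ) = Nat.gcd k.natAbs (a * b) := by
          simp [Int.gcd, Int.natAbs_mul]
        rw [this] at hk; exact hk
      have hka : Int.gcd (k * (b : ℤ) ^ 2) a = 1 := by
        simp only [Int.gcd, Int.natAbs_mul, Int.natAbs_pow, Int.natAbs_natCast]
        exact Nat.Coprime.mul_left (hk0.coprime_mul_right_right) (Nat.Coprime.pow_left 2 hab.symm)
      have hkb : Int.gcd (k * (a : ℤ) ^ 2) b = 1 := by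
        simp only [Int.gcd, Int.natAbs_mul, Int.natAbs_pow, Int.natAbs_natCast]
        exact Nat.Coprime.mul_left (hk0.coprime_mul_left_right) (Nat.Coprime.pow_left 2 hab)
      have h1 := iha (by omega) _ hka
      have h2 := ihb (by omega) _ hkb
      rw [huaT_mul a b (by omega) (by omega) hab, norm_mul, wmul a b hab,
        hab.primeFactors_mul, Finset.filter_union,
        Finset.card_union_of_disjoint (Finset.disjoint_filter_filter hab.disjoint_primeFactors),
        pow_add]
      calc _ ≤ (K ^ (a.primeFactors.filter (· < P0)).card * w a) *
            (K ^ (b.primeFactors.filter (· < P0)).card * w b) :=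
            mul_le_mul h1 h2 (norm_nonneg _) (mul_nonneg (by positivity) (wnn _))
        _ = _ := by ring
  intro hc k hk
  refine (main hc k hk).trans (mul_le_mul_of_nonneg_right ?_ (wnn _))
  apply pow_le_pow_right₀ hK
  calc (c.primeFactors.filter (· < P0)).card ≤ (Finset.range P0).card := by
        apply Finset.card_le_card
        intro x hx
        exact Finset.mem_range.2 (Finset.mem_filter.1 hx).2
    _ = P0 := Finset.card_range _

/-- Hua's bounds for complete cubic exponential sums: for gcd(k,c) = 1,
|∑_{d=1}^c e((kd³+ld)/c)| ≤ C c^{1/2+ε} gcd(l,c), and |∑_{d=1}^c e(kd³/c)| ≤ C c^{2/3}. -/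
theorem stmt_19 (ε : ℝ) (hε : 0 < ε) :
    ∃ C > 0, ∀ (c : ℕ), 0 < c → ∀ (k l : ℤ), Int.gcd k c = 1 →
      ‖∑ d ∈ Finset.range c,
          Complex.exp (2 * Real.pi * Complex.I * ((k * d ^ 3 + l * d : ℤ) : ℂ) / c)‖ ≤
        C * (c : ℝ) ^ ((1 : ℝ) / 2 + ε) * (Int.gcd l c : ℝ) ∧
      ‖∑ d ∈ Finset.range c,
          Complex.exp (2 * Real.pi * Complex.I * ((k * d ^ 3 : ℤ) : ℂ) / c)‖ ≤
        C * (c : ℝ) ^ ((2 : ℝ) / 3) := by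
  obtain ⟨P0, hP0⟩ := exists_nat_ge ((54 : ℝ) ^ (1 / ε))
  have hC1 : (0 : ℝ) < 54 ^ P0 := by positivity
  have hC2 : (0 : ℝ) < 4096 ^ 64 := by positivity
  refine ⟨54 ^ P0 + 4096 ^ 64, by positivity, ?_⟩
  intro c hc k l hk
  constructor
  · have h := hua_global P0 54 (by norm_num)
      (fun n => (n : ℝ) ^ ((1 : ℝ) / 2 + ε) * (Int.gcd l n : ℝ)) (by simp)
      (fun n => by positivity) (by
        intro m n hmn
        simp only [Nat.cast_mul]
        rw [Real.mul_rpow (by positivity) (by positivity)]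
        have : Int.gcd l ((m : ℤ) * n) = Int.gcd l m * Int.gcd l n := by
          simp only [Int.gcd, Int.natAbs_mul, Int.natAbs_natCast]
          exact Nat.Coprime.gcd_mul _ hmn
        rw [this]; push_cast; ring) l (by
        intro p a k hp ha hk
        refine (huaT_primePow p hp a ha k l hk).trans ?_
        have hq1 : (1 : ℝ) ≤ ((p ^ a : ℕ) : ℝ) := by exact_mod_cast Nat.one_le_pow _ _ hp.pos
        have e1 : Real.sqrt ((p : ℝ) ^ a) = ((p ^ a : ℕ) : ℝ) ^ ((1 : ℝ) / 2) := by
          rw [Real.sqrt_eq_rpow]; push_cast; rfl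
        rw [e1, Real.rpow_add (by linarith)]
        have hkey : (54 : ℝ) ≤ (if p < P0 then 54 else 1) * ((p ^ a : ℕ) : ℝ) ^ ε := by
          split_ifs with hlt
          · have := Real.one_le_rpow hq1 hε.le
            linarith
          · rw [one_mul]
            have h1 : (54 : ℝ) ^ (1 / ε) ≤ ((p ^ a : ℕ) : ℝ) := by
              refine hP0.trans ?_
              have h2 : P0 ≤ p ^ a := (not_lt.1 hlt).trans (Nat.le_self_pow ha.ne' p)
              exact_mod_cast h2
            have h2 := Real.rpow_le_rpow (by positivity) h1 hε.le
            rw [← Real.rpow_mul (by norm_num), one_div, inv_mul_cancel₀ hε.ne', Real.rpow_one] at h2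
            exact h2
        calc 54 * ((p ^ a : ℕ) : ℝ) ^ ((1 : ℝ) / 2) * (Int.gcd l (p ^ a : ℕ) : ℝ)
            ≤ ((if p < P0 then 54 else 1) * ((p ^ a : ℕ) : ℝ) ^ ε) *
              ((p ^ a : ℕ) : ℝ) ^ ((1 : ℝ) / 2) * (Int.gcd l (p ^ a : ℕ) : ℝ) := by gcongr
          _ = _ := by ring) c hc k hk
    have heq : ∑ d ∈ Finset.range c,
          Complex.exp (2 * Real.pi * Complex.I * ((k * d ^ 3 + l * d : ℤ) : ℂ) / c)
          = huaT c k l := rfl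
    rw [heq, mul_assoc]
    refine h.trans ?_
    apply mul_le_mul_of_nonneg_right _ (by positivity)
    linarith
  · have h := hua_global 64 4096 (by norm_num)
      (fun n => (n : ℝ) ^ ((2 : ℝ) / 3)) (by simp)
      (fun n => by positivity) (by
        intro m n _
        simp only [Nat.cast_mul]
        rw [Real.mul_rpow (by positivity) (by positivity)]) 0 (by
        intro p a k hp _ hk
        split_ifs with hlt
        · exact huaT_cube_small p hp hlt k hk a
        · exact huaT_cube_large p hp (not_lt.1 hlt) k hk a) c hc k hk
    have heq : ∑ d ∈ Finset.range c,
          Complex.exp (2 * Real.pi * Complex.I * ((k * d ^ 3 : ℤ) : ℂ) / c)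
          = huaT c k 0 := by
      unfold huaT huaE; simp
    rw [heq]
    refine h.trans ?_
    apply mul_le_mul_of_nonneg_right _ (by positivity)
    linarith
end
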